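/- arXiv:1703.06334 — 10 statements merged into one kernel-verified Lean document; each statement's English description precedes it below -/
import Mathlib

section
/- Let n ≥ 1 be a natural number, d ≥ 1, let β_1,…,β_d and γ_1,…,γ_d be positive reals, and let ω : ℝ → ℝ satisfy β_j + γ_j ω(0) > 0 for all j = s+1,…,d. Fix s with 1 ≤ s ≤ d and fixed components z_1,…,z_{s−1} ∈ {0,1,…,n−1}. Then a value z_s ∈ {0,1,…,n−1} minimizes the map z ↦ e²_{n,d}(z_1,…,z_{s−1},z,0,…,0) over {0,1,…,n−1} if and only if it minimizes the map z ↦ e²_{n,s}(z_1,…,z_{s−1},z) over {0,1,…,n−1}. Consequently, the successive coordinate search algorithm started from the all-zero initial vector selects, in every step, exactly the same minimizing components as the component-by-component algorithm. -/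
/-- The squared worst-case error of the rank-1 lattice rule with `n` points in dimension `d`,
with weights `β`, `γ`, kernel function `ω`, and generating vector `z` (with values in
`{0, 1, …, n−1}`). -/
noncomputable def sqWce (n d : ℕ) (β γ : ℕ → ℝ) (ω : ℝ → ℝ) (z : ℕ → ℕ) : ℝ :=
  - ∏ j ∈ Finset.range d, β j
  + (1 / (n : ℝ)) * ∑ k ∈ Finset.range n, ∏ j ∈ Finset.range d,
      (β j + γ j * ω (Int.fract ((k : ℝ) * (z j : ℝ) / (n : ℝ))))

/-- If the components of `z` from index `m` on vanish, the error in dimension `d` is an affine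
function of the error in dimension `m`, with coefficients independent of `z`. -/
theorem sqWce_eq_of_tail_zero {n d m : ℕ} (hmd : m ≤ d) (β γ : ℕ → ℝ) (ω : ℝ → ℝ) (z : ℕ → ℕ)
    (hz : ∀ j, m ≤ j → j < d → z j = 0) :
    sqWce n d β γ ω z = - ∏ j ∈ Finset.range d, β j
      + (∏ j ∈ Finset.Ico m d, (β j + γ j * ω 0))
        * (sqWce n m β γ ω z + ∏ j ∈ Finset.range m, β j) := by
  have hprod (k : ℕ) : ∏ j ∈ Finset.range d,
      (β j + γ j * ω (Int.fract ((k : ℝ) * (z j : ℝ) / (n : ℝ)))) =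
      (∏ j ∈ Finset.range m, (β j + γ j * ω (Int.fract ((k : ℝ) * (z j : ℝ) / (n : ℝ)))))
        * ∏ j ∈ Finset.Ico m d, (β j + γ j * ω 0) := by
    rw [← Finset.prod_range_mul_prod_Ico _ hmd]
    congr 1
    refine Finset.prod_congr rfl fun j hj => ?_
    obtain ⟨h₁, h₂⟩ := Finset.mem_Ico.mp hj
    simp [hz j h₁ h₂]
  simp only [sqWce, hprod, ← Finset.sum_mul]
  ring

/-- Fix a step `s` (0-based index of the free component, so `s < d`; this is step `s+1` in
1-based numbering) and fixed earlier components `p 0, …, p (s-1)` in `{0,…,n−1}`.  Assuming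
`β_j + γ_j ω(0) > 0` for the later coordinates, a value `zs ∈ {0,…,n−1}` minimizes
`z ↦ e²_{n,d}(p_1,…,p_{s}, z, 0,…,0)` over `{0,…,n−1}` if and only if it minimizes
`z ↦ e²_{n,s+1}(p_1,…,p_{s}, z)` over `{0,…,n−1}`.  Hence the SCS algorithm started from the
all-zero vector selects, in every step, exactly the same minimizing components as the CBC
algorithm. -/
theorem scs_zero_start_minimizer_iff_cbc (n d s : ℕ) (hn : 1 ≤ n) (hd : 1 ≤ d) (hs : s < d)
    (β γ : ℕ → ℝ) (hβ : ∀ j, 0 < β j) (hγ : ∀ j, 0 < γ j) (ω : ℝ → ℝ)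
    (hpos : ∀ j, s < j → j < d → 0 < β j + γ j * ω 0)
    (p : ℕ → ℕ) (hp : ∀ j < s, p j < n) (zs : ℕ) (hzs : zs < n) :
    (∀ z < n,
        sqWce n d β γ ω (fun j => if j < s then p j else if j = s then zs else 0)
          ≤ sqWce n d β γ ω (fun j => if j < s then p j else if j = s then z else 0))
      ↔
    (∀ z < n,
        sqWce n (s + 1) β γ ω (fun j => if j < s then p j else if j = s then zs else 0)
          ≤ sqWce n (s + 1) β γ ω (fun j => if j < s then p j else if j = s then z else 0)) := by
  have haff (z : ℕ) := sqWce_eq_of_tail_zero (n := n) (Nat.succ_le_of_lt hs) β γ ω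
    (fun j => if j < s then p j else if j = s then z else 0)
    (fun j h₁ _ => by simp [show ¬ j < s by lia, show j ≠ s by lia])
  have hC : 0 < ∏ j ∈ Finset.Ico (s + 1) d, (β j + γ j * ω 0) :=
    Finset.prod_pos fun j hj =>
      hpos j (Nat.lt_of_succ_le (Finset.mem_Ico.mp hj).1) (Finset.mem_Ico.mp hj).2
  refine forall₂_congr fun z _ => ?_
  rw [haff zs, haff z, add_le_add_iff_left, mul_le_mul_iff_right₀ hC, add_le_add_iff_right]
end

section
/- Let n ≥ 1 be a natural number, d ≥ 1, let β_1,…,β_d and γ_1,…,γ_d be positive reals, and let ω : ℝ → ℝ. Let z⁰ ∈ {0,1,…,n−1}^d and let z* ∈ {0,1,…,n−1}^d be an output of the successive coordinate search algorithm started from z⁰. Then e²_{n,d}(z*) ≤ e²_{n,d}(z⁰), i.e., the SCS method constructs a generating vector whose squared worst-case error is at most that of the initial vector. -/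
/-- If `z*` is an output of the successive coordinate search algorithm started from the
initial vector `z⁰` (i.e. for every step `s < d` (0-based) and every candidate `z < n`,
the hybrid vector `(z*_0,…,z*_s, z⁰_{s+1},…,z⁰_{d-1})` has squared worst-case error at most
that of `(z*_0,…,z*_{s-1}, z, z⁰_{s+1},…,z⁰_{d-1})`), then `e²_{n,d}(z*) ≤ e²_{n,d}(z⁰)`. -/
theorem scs_le_initial (n d : ℕ) (hn : 1 ≤ n) (hd : 1 ≤ d)
    (β γ : ℕ → ℝ) (hβ : ∀ j, 0 < β j) (hγ : ∀ j, 0 < γ j) (ω : ℝ → ℝ)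
    (z0 zstar : ℕ → ℕ) (hz0 : ∀ j < d, z0 j < n) (hzstar : ∀ j < d, zstar j < n)
    (hscs : ∀ s < d, ∀ z < n,
      sqWce n d β γ ω (fun j => if j ≤ s then zstar j else z0 j)
        ≤ sqWce n d β γ ω (fun j => if j < s then zstar j else if j = s then z else z0 j)) :
    sqWce n d β γ ω zstar ≤ sqWce n d β γ ω z0 := by
  have step : ∀ s ≤ d,
      sqWce n d β γ ω (fun j => if j < s then zstar j else z0 j) ≤ sqWce n d β γ ω z0 := by
    intro s
    induction s with
    | zero => simp
    | succ s ih =>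
      intro hs
      have h := hscs s (by omega) (z0 s) (hz0 s (by omega))
      have hprev : (fun j => if j < s then zstar j else if j = s then z0 s else z0 j)
          = fun j => if j < s then zstar j else z0 j := by
        funext j
        split_ifs <;> simp_all
      rw [hprev] at h
      simpa only [Nat.lt_succ_iff] using h.trans (ih (by omega))
  have hcongr : sqWce n d β γ ω zstar
      = sqWce n d β γ ω (fun j => if j < d then zstar j else z0 j) := by
    unfold sqWce
    congr 2
    refine Finset.sum_congr rfl fun k _ => Finset.prod_congr rfl fun j hj => ?_
    simp only [if_pos (Finset.mem_range.mp hj)]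
  exact hcongr.trans_le (step d le_rfl)
end

section
/- Let n be a prime number, d ≥ 1, s ∈ {1,…,d}, and let z_j ∈ ℤ for j ∈ {1,…,d} \ {s} be arbitrary fixed integers. Let r : ℤ → ℝ satisfy r(h) > 0 for all h and r(n h) ≥ n^c · r(h) for all h ≠ 0, where c ≥ 1, and assume that Σ_{h ∈ (ℤ\{0})^d} ∏_{j=1}^d r(h_j)^{−1} converges. Then 0 ≤ (1/n) Σ_{z_s=0}^{n−1} Σ_{h ∈ (ℤ\{0})^d, h·z ≡ 0 (mod n)} ∏_{j=1}^d r(h_j)^{−1} ≤ (2/n) Σ_{h ∈ (ℤ\{0})^d} ∏_{j=1}^d r(h_j)^{−1}, where h·z = Σ_{j=1}^d h_j z_j. -/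
/-- The sum `∑_{h ∈ (ℤ∖{0})^d, h·z ≡ 0 (mod n)} ∏_{j=1}^d r(h_j)⁻¹` over the dual lattice. -/
noncomputable def dualSum (n d : ℕ) (r : ℤ → ℝ) (z : Fin d → ℤ) : ℝ :=
  ∑' h : Fin d → ℤ,
    if (∀ j, h j ≠ 0) ∧ (n : ℤ) ∣ ∑ j, h j * z j then ∏ j, (r (h j))⁻¹ else 0

/-- The summand `∏ j, (r (h j))⁻¹`, restricted to vectors with all components nonzero. -/
noncomputable def invWeight {d : ℕ} (r : ℤ → ℝ) (h : Fin d → ℤ) : ℝ :=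
  if ∀ j, h j ≠ 0 then ∏ j, (r (h j))⁻¹ else 0

theorem invWeight_nonneg {d : ℕ} {r : ℤ → ℝ} (hr : ∀ h, 0 < r h) (h : Fin d → ℤ) :
    0 ≤ invWeight r h := by
  unfold invWeight
  split_ifs
  · exact Finset.prod_nonneg fun j _ => (inv_pos.2 (hr _)).le
  · exact le_rfl

theorem dualSum_eq_tsum_invWeight (n d : ℕ) (r : ℤ → ℝ) (z : Fin d → ℤ) :
    dualSum n d r z =
      ∑' h : Fin d → ℤ, if (n : ℤ) ∣ ∑ j, h j * z j then invWeight r h else 0 := by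
  refine tsum_congr fun h => ?_
  unfold invWeight
  simp only [ite_and]
  split_ifs <;> rfl

theorem sum_mul_update {d : ℕ} (h z : Fin d → ℤ) (s : Fin d) (a : ℤ) :
    ∑ j, h j * Function.update z s a j = h s * a + ∑ j ∈ Finset.univ.erase s, h j * z j := by
  rw [← Finset.add_sum_erase _ _ (Finset.mem_univ s), Function.update_self]
  congr 1
  refine Finset.sum_congr rfl fun j hj => ?_
  rw [Function.update_of_ne (Finset.ne_of_mem_erase hj)]

/-- For `n` prime and `n ∤ a`, the congruence `a * x + b ≡ 0 (mod n)` has at most one solution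
in `{0, …, n - 1}`. -/
theorem card_filter_dvd_mul_add_le_one {n : ℕ} (hn : n.Prime) {a : ℤ} (ha : ¬ (n : ℤ) ∣ a)
    (b : ℤ) : ((Finset.range n).filter fun x : ℕ => (n : ℤ) ∣ a * x + b).card ≤ 1 := by
  refine Finset.card_le_one.2 fun x hx y hy => ?_
  simp only [Finset.mem_filter, Finset.mem_range] at hx hy
  have hdvd : (n : ℤ) ∣ a * (x - y) := by
    have := dvd_sub hx.2 hy.2
    rwa [show a * x + b - (a * y + b) = a * ((x : ℤ) - y) by ring] at this
  have hxy : (n : ℤ) ∣ (x : ℤ) - y :=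
    ((Nat.prime_iff_prime_int.1 hn).dvd_or_dvd hdvd).resolve_left ha
  have := Int.eq_zero_of_abs_lt_dvd hxy (by rw [abs_lt]; omega)
  omega

theorem mul_invWeight_update_le {n d : ℕ} (hn : n.Prime) (s : Fin d) {c : ℝ} (hc : 1 ≤ c)
    {r : ℤ → ℝ} (hr : ∀ h, 0 < r h)
    (hrn : ∀ h : ℤ, h ≠ 0 → (n : ℝ) ^ c * r h ≤ r (n * h)) (h : Fin d → ℤ) :
    n * invWeight r (Function.update h s (n * h s)) ≤ invWeight r h := by
  by_cases hh : ∀ j, h j ≠ 0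
  · have hh' : ∀ j, Function.update h s (n * h s) j ≠ 0 := by
      intro j
      rcases eq_or_ne j s with rfl | hj
      · simpa using ⟨hn.ne_zero, hh j⟩
      · simpa [hj] using hh j
    rw [invWeight, invWeight, if_pos hh, if_pos hh',
      ← Finset.mul_prod_erase _ _ (Finset.mem_univ s),
      ← Finset.mul_prod_erase _ _ (Finset.mem_univ s), Function.update_self, ← mul_assoc]
    have hprod : ∏ j ∈ Finset.univ.erase s, (r (Function.update h s (n * h s) j))⁻¹ =
        ∏ j ∈ Finset.univ.erase s, (r (h j))⁻¹ :=
      Finset.prod_congr rfl fun j hj => by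
        rw [Function.update_of_ne (Finset.ne_of_mem_erase hj)]
    rw [hprod]
    refine mul_le_mul_of_nonneg_right ?_
      (Finset.prod_nonneg fun j _ => (inv_pos.2 (hr _)).le)
    have hnc : (n : ℝ) ≤ (n : ℝ) ^ c :=
      Real.self_le_rpow_of_one_le (by exact_mod_cast hn.one_le) hc
    have hle : (n : ℝ) * r (h s) ≤ r (n * h s) :=
      (mul_le_mul_of_nonneg_right hnc (hr _).le).trans (hrn _ (hh s))
    rw [← div_eq_mul_inv, div_le_iff₀ (hr _), inv_mul_eq_div, le_div_iff₀ (hr _)]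
    exact hle
  · have hh' : ¬ ∀ j, Function.update h s (n * h s) j ≠ 0 := by
      intro H
      refine hh fun j => ?_
      have := H j
      rcases eq_or_ne j s with rfl | hj
      · rw [Function.update_self] at this
        exact right_ne_zero_of_mul this
      · rwa [Function.update_of_ne hj] at this
    rw [invWeight, invWeight, if_neg hh, if_neg hh', mul_zero]

theorem tsum_dvd_mul_invWeight_le {n d : ℕ} (hn : n.Prime) (s : Fin d) {c : ℝ} (hc : 1 ≤ c)
    {r : ℤ → ℝ} (hr : ∀ h, 0 < r h)
    (hrn : ∀ h : ℤ, h ≠ 0 → (n : ℝ) ^ c * r h ≤ r (n * h))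
    (hsum : Summable (invWeight r : (Fin d → ℤ) → ℝ)) :
    ∑' h : Fin d → ℤ, (if (n : ℤ) ∣ h s then n * invWeight r h else 0) ≤
      ∑' h : Fin d → ℤ, invWeight r h := by
  have hinj : Function.Injective fun h : Fin d → ℤ => Function.update h s (n * h s) := by
    intro h h' H
    funext j
    have hj := congrFun H j
    rcases eq_or_ne j s with rfl | hne
    · simpa [hn.ne_zero] using hj
    · simpa [hne] using hj
  have hsupp : Function.support
      (fun h : Fin d → ℤ => if (n : ℤ) ∣ h s then n * invWeight r h else 0) ⊆
      Set.range fun h : Fin d → ℤ => Function.update h s (n * h s) := by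
    intro h hh
    have hdvd : (n : ℤ) ∣ h s := by
      by_contra H
      exact hh (if_neg H)
    obtain ⟨k, hk⟩ := hdvd
    exact ⟨Function.update h s k, by simp [← hk]⟩
  rw [← hinj.tsum_eq hsupp]
  have hle : ∀ h : Fin d → ℤ,
      (if (n : ℤ) ∣ Function.update h s (n * h s) s then
        n * invWeight r (Function.update h s (n * h s)) else 0) ≤ invWeight r h := by
    intro h
    rw [if_pos (by simp)]
    exact mul_invWeight_update_le hn s hc hr hrn h
  refine Summable.tsum_le_tsum hle (hsum.of_nonneg_of_le (fun h => ?_) hle) hsum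
  split_ifs
  · exact mul_nonneg n.cast_nonneg (invWeight_nonneg hr _)
  · exact le_rfl

theorem sum_dvd_invWeight_le {n d : ℕ} (hn : n.Prime) (s : Fin d) (z : Fin d → ℤ)
    {r : ℤ → ℝ} (hr : ∀ h, 0 < r h) (h : Fin d → ℤ) :
    ∑ a ∈ Finset.range n,
        (if (n : ℤ) ∣ ∑ j, h j * Function.update z s (a : ℤ) j then invWeight r h else 0) ≤
      invWeight r h + if (n : ℤ) ∣ h s then n * invWeight r h else 0 := by
  have hw := invWeight_nonneg hr h
  rw [← Finset.sum_filter, Finset.sum_const, nsmul_eq_mul]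
  split_ifs with hdvd
  · have hcard : (((Finset.range n).filter fun a : ℕ =>
        (n : ℤ) ∣ ∑ j, h j * Function.update z s (a : ℤ) j).card : ℝ) ≤ n := by
      exact_mod_cast (Finset.card_filter_le _ _).trans (Finset.card_range n).le
    exact (mul_le_mul_of_nonneg_right hcard hw).trans (le_add_of_nonneg_left hw)
  · rw [add_zero]
    refine mul_le_of_le_one_left hw ?_
    simp only [sum_mul_update]
    exact_mod_cast card_filter_dvd_mul_add_le_one hn hdvd _


/-- Averaging lemma: for `n` prime, `s ∈ {1,…,d}`, arbitrary fixed integers `z_j` for `j ≠ s`,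
and `r : ℤ → ℝ` positive with `r(nh) ≥ n^c r(h)` for `h ≠ 0` and some `c ≥ 1` (assuming the
full sum converges),
`0 ≤ (1/n) ∑_{z_s=0}^{n−1} ∑_{h ∈ (ℤ∖{0})^d, h·z ≡ 0 (n)} r(h)⁻¹
   ≤ (2/n) ∑_{h ∈ (ℤ∖{0})^d} r(h)⁻¹`. -/
theorem averaging_lemma (n : ℕ) (hn : n.Prime) (d : ℕ) (hd : 1 ≤ d) (s : Fin d)
    (z : Fin d → ℤ) (c : ℝ) (hc : 1 ≤ c)
    (r : ℤ → ℝ) (hr : ∀ h, 0 < r h)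
    (hrn : ∀ h : ℤ, h ≠ 0 → (n : ℝ) ^ c * r h ≤ r (n * h))
    (hsum : Summable fun h : Fin d → ℤ =>
      if ∀ j, h j ≠ 0 then ∏ j, (r (h j))⁻¹ else 0) :
    0 ≤ (1 / (n : ℝ)) *
        ∑ zs ∈ Finset.range n, dualSum n d r (Function.update z s (zs : ℤ)) ∧
    (1 / (n : ℝ)) *
        ∑ zs ∈ Finset.range n, dualSum n d r (Function.update z s (zs : ℤ))
      ≤ (2 / (n : ℝ)) *
        ∑' h : Fin d → ℤ, if ∀ j, h j ≠ 0 then ∏ j, (r (h j))⁻¹ else 0 := by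
  have hsum' : Summable (invWeight r : (Fin d → ℤ) → ℝ) := hsum
  have hsummable : ∀ a ∈ Finset.range n, Summable fun h : Fin d → ℤ =>
      if (n : ℤ) ∣ ∑ j, h j * Function.update z s (a : ℤ) j then invWeight r h else 0 := by
    intro a _
    refine hsum'.of_nonneg_of_le (fun h => ?_) fun h => ?_
    all_goals
      have := invWeight_nonneg hr h
      split_ifs <;> simp [this]
  have hdvd : Summable fun h : Fin d → ℤ =>
      if (n : ℤ) ∣ h s then n * invWeight r h else 0 := by
    refine (hsum'.mul_left (n : ℝ)).of_nonneg_of_le (fun h => ?_) fun h => ?_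
    all_goals
      have := mul_nonneg (n.cast_nonneg (α := ℝ)) (invWeight_nonneg hr h)
      split_ifs <;> simp only [this, le_refl]
  refine ⟨mul_nonneg (by positivity) (Finset.sum_nonneg fun a _ => ?_), ?_⟩
  · rw [dualSum_eq_tsum_invWeight]
    refine tsum_nonneg fun h => ?_
    have := invWeight_nonneg hr h
    split_ifs <;> simp [this]
  · change _ ≤ 2 / (n : ℝ) * ∑' h : Fin d → ℤ, invWeight r h
    have hmain : ∑ a ∈ Finset.range n, dualSum n d r (Function.update z s (a : ℤ)) ≤
        2 * ∑' h : Fin d → ℤ, invWeight r h := by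
      simp only [dualSum_eq_tsum_invWeight]
      rw [← Summable.tsum_finsetSum hsummable]
      refine (Summable.tsum_le_tsum (sum_dvd_invWeight_le hn s z hr)
        (summable_sum hsummable) (hsum'.add hdvd)).trans ?_
      rw [hsum'.tsum_add hdvd, two_mul]
      exact add_le_add le_rfl (tsum_dvd_mul_invWeight_le hn s hc hr hrn hsum')
    calc _ ≤ 1 / (n : ℝ) * (2 * ∑' h : Fin d → ℤ, invWeight r h) := by gcongr
      _ = _ := by ring
end

section
/- Let n ≥ 2 be a natural number, c ≥ 1, d ≥ 1, and s ∈ {1,…,d}. Let r : ℤ → ℝ satisfy r(h) > 0 for all h and r(n h) ≥ n^c · r(h) for all h ≠ 0, and assume Σ_{h ∈ (ℤ\{0})^d} ∏_{j=1}^d r(h_j)^{−1} converges. Then Σ over h ∈ (ℤ\{0})^d with h_s ≡ 0 (mod n) of ∏_{j=1}^d r(h_j)^{−1} is at most n^{−c} · Σ_{h ∈ (ℤ\{0})^d} ∏_{j=1}^d r(h_j)^{−1}, and in particular at most n^{−1} times that sum. -/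
/-- Multiplying one coordinate by `n` scales the weight `∏ j, (r (h j))⁻¹` by at most `n ^ (-c)`. -/
theorem prod_inv_update_mul_le {ι : Type*} [Fintype ι] [DecidableEq ι] {n : ℕ} (hn : 0 < n)
    {c : ℝ} {r : ℤ → ℝ} (hr : ∀ h, 0 < r h)
    (hrn : ∀ h : ℤ, h ≠ 0 → (n : ℝ) ^ c * r h ≤ r (n * h)) (h : ι → ℤ) (s : ι) (hs : h s ≠ 0) :
    ∏ j, (r (Function.update h s (n * h s) j))⁻¹ ≤ (n : ℝ) ^ (-c) * ∏ j, (r (h j))⁻¹ := by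
  have hnc : 0 < (n : ℝ) ^ c := Real.rpow_pos_of_pos (by exact_mod_cast hn) c
  have hrest : ∏ j ∈ Finset.univ.erase s, (r (Function.update h s (n * h s) j))⁻¹ =
      ∏ j ∈ Finset.univ.erase s, (r (h j))⁻¹ :=
    Finset.prod_congr rfl fun j hj => by
      rw [Function.update_of_ne (Finset.ne_of_mem_erase hj)]
  rw [← Finset.mul_prod_erase _ _ (Finset.mem_univ s), hrest,
    ← Finset.mul_prod_erase (a := s) _ (fun j => (r (h j))⁻¹) (Finset.mem_univ s),
    Function.update_self, ← mul_assoc, Real.rpow_neg n.cast_nonneg, ← mul_inv]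
  exact mul_le_mul_of_nonneg_right
    (inv_anti₀ (mul_pos hnc (hr _)) (hrn _ hs))
    (Finset.prod_nonneg fun j _ => (inv_pos.2 (hr _)).le)

/-- Multiplication of one coordinate by a nonzero integer is injective. -/
theorem update_mul_injective {ι : Type*} [DecidableEq ι] {m : ℤ} (hm : m ≠ 0) (s : ι) :
    Function.Injective fun h : ι → ℤ => Function.update h s (m * h s) := by
  intro a b hab
  funext j
  have hj := congrFun hab j
  by_cases hjs : j = s
  · subst hjs
    simpa [hm] using hj
  · simpa [hjs] using hj

/-- Let `n ≥ 2`, `c ≥ 1`, `d ≥ 1`, `s ∈ {1,…,d}`, and let `r : ℤ → ℝ` be positive with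
`r(nh) ≥ n^c r(h)` for all `h ≠ 0`, with `∑_{h ∈ (ℤ∖{0})^d} ∏_j r(h_j)⁻¹` convergent.
Then the sum over those `h ∈ (ℤ∖{0})^d` with `h_s ≡ 0 (mod n)` of `∏_j r(h_j)⁻¹` is at most
`n^{−c}` times the full sum, and in particular at most `n^{−1}` times the full sum. -/
theorem divisible_coordinate_sum_le (n : ℕ) (hn : 2 ≤ n) (c : ℝ) (hc : 1 ≤ c)
    (d : ℕ) (hd : 1 ≤ d) (s : Fin d)
    (r : ℤ → ℝ) (hr : ∀ h, 0 < r h)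
    (hrn : ∀ h : ℤ, h ≠ 0 → (n : ℝ) ^ c * r h ≤ r (n * h))
    (hsum : Summable fun h : Fin d → ℤ =>
      if ∀ j, h j ≠ 0 then ∏ j, (r (h j))⁻¹ else 0) :
    (∑' h : Fin d → ℤ,
        if (∀ j, h j ≠ 0) ∧ (n : ℤ) ∣ h s then ∏ j, (r (h j))⁻¹ else 0)
      ≤ (n : ℝ) ^ (-c) *
        ∑' h : Fin d → ℤ, (if ∀ j, h j ≠ 0 then ∏ j, (r (h j))⁻¹ else 0) ∧
    (∑' h : Fin d → ℤ,
        if (∀ j, h j ≠ 0) ∧ (n : ℤ) ∣ h s then ∏ j, (r (h j))⁻¹ else 0)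
      ≤ (n : ℝ)⁻¹ *
        ∑' h : Fin d → ℤ, (if ∀ j, h j ≠ 0 then ∏ j, (r (h j))⁻¹ else 0) := by
  have hn0 : (n : ℤ) ≠ 0 := by omega
  have hn1 : (1 : ℝ) ≤ n := by exact_mod_cast (by omega : 1 ≤ n)
  have hpos : ∀ h : Fin d → ℤ, 0 ≤ ∏ j, (r (h j))⁻¹ := fun h =>
    Finset.prod_nonneg fun j _ => (inv_pos.2 (hr _)).le
  have hinj := update_mul_injective hn0 s
  have key : (∑' h : Fin d → ℤ,
        if (∀ j, h j ≠ 0) ∧ (n : ℤ) ∣ h s then ∏ j, (r (h j))⁻¹ else 0)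
      ≤ (n : ℝ) ^ (-c) *
        ∑' h : Fin d → ℤ, (if ∀ j, h j ≠ 0 then ∏ j, (r (h j))⁻¹ else 0) := by
    have hsub : Summable fun h : Fin d → ℤ =>
        if (∀ j, h j ≠ 0) ∧ (n : ℤ) ∣ h s then ∏ j, (r (h j))⁻¹ else 0 := by
      refine hsum.of_nonneg_of_le (fun h => ?_) fun h => ?_
      · split_ifs
        exacts [hpos h, le_rfl]
      · by_cases h0 : ∀ j, h j ≠ 0
        · rw [if_pos h0]
          split_ifs
          exacts [le_rfl, hpos h]
        · rw [if_neg h0, if_neg fun hh => h0 hh.1]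
    rw [← tsum_mul_left, ← hinj.tsum_eq]
    · refine (hsub.comp_injective hinj).tsum_le_tsum (fun h => ?_) (hsum.mul_left _)
      by_cases h0 : ∀ j, h j ≠ 0
      · rw [if_pos h0]
        split_ifs
        · exact prod_inv_update_mul_le (by omega) hr hrn h s (h0 s)
        · exact mul_nonneg (Real.rpow_nonneg n.cast_nonneg _) (hpos h)
      · rw [if_neg h0, mul_zero, if_neg]
        rintro ⟨hne, -⟩
        refine h0 fun j hj => hne j ?_
        by_cases hjs : j = s
        · subst hjs
          simp [hj]
        · simpa [hjs] using hj
    · intro h hh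
      have hh' : (∀ j, h j ≠ 0) ∧ (n : ℤ) ∣ h s := by
        by_contra hcon
        exact hh (if_neg hcon)
      obtain ⟨k, hk⟩ := hh'.2
      exact ⟨Function.update h s k, by simp [← hk]⟩
  refine ⟨key, key.trans (mul_le_mul_of_nonneg_right ?_ (tsum_nonneg fun h => ?_))⟩
  · rw [← Real.rpow_neg_one]
    exact Real.rpow_le_rpow_of_exponent_le hn1 (by linarith)
  · split_ifs
    exacts [hpos h, le_rfl]
end

section
/- Let α > 1/2, n ≥ 1 a natural number, d ≥ 1, β_1,…,β_d and γ_1,…,γ_d positive reals, and z ∈ ℤ^d. Define ω_α : ℝ → ℝ by ω_α(x) = Σ_{0 ≠ h ∈ ℤ} e^{2πi h x} / r_α(h) (a convergent series with real values). Then −∏_{j=1}^d β_j + (1/n) Σ_{k=0}^{n−1} ∏_{j=1}^d ( β_j + γ_j ω_α({k z_j / n}) ) = Σ over h ∈ ℤ^d \ {0} with h·z ≡ 0 (mod n) of r_α(h)^{−1} ∏_{j : h_j ≠ 0} γ_j ∏_{j : h_j = 0} β_j, where both sides are convergent and {·} denotes the fractional part. -/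
/-- `r_α(h) = |h|^{2α}` for `h ≠ 0` and `r_α(0) = 1`. -/
noncomputable def rAlpha (α : ℝ) (h : ℤ) : ℝ :=
  if h = 0 then 1 else |(h : ℝ)| ^ (2 * α)

/-- `ω_α(x) = ∑_{0 ≠ h ∈ ℤ} e^{2πi h x} / r_α(h)`, a convergent series with real values
(formalized as the real part of the complex series). -/
noncomputable def omegaAlpha (α : ℝ) (x : ℝ) : ℝ :=
  (∑' h : ℤ, if h = 0 then (0 : ℂ)
    else Complex.exp (2 * (Real.pi : ℂ) * Complex.I * (h : ℂ) * (x : ℂ)) / (rAlpha α h : ℂ)).re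

/-- A finite product of absolutely convergent series is the sum over the product index set. -/
theorem summable_norm_and_hasSum_prod_pi {ι 𝕜 : Type*} [NormedField 𝕜] [CompleteSpace 𝕜] (d : ℕ)
    (f : Fin d → ι → 𝕜) (hf : ∀ j, Summable fun i => ‖f j i‖) :
    Summable (fun h : Fin d → ι => ‖∏ j, f j (h j)‖) ∧
      HasSum (fun h : Fin d → ι => ∏ j, f j (h j)) (∏ j, ∑' i, f j i) := by
  induction d with
  | zero => exact ⟨(hasSum_fintype _).summable, by simp⟩
  | succ d ih =>
    obtain ⟨hs, ht⟩ := ih (fun j => f j.succ) fun j => hf j.succ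
    have hnorm := Summable.mul_norm (hf 0) hs
    have hsum := (hf 0).of_norm.hasSum.mul ht hnorm.of_norm
    refine ⟨?_, ?_⟩
    · rw [← (Fin.consEquiv fun _ : Fin (d + 1) => ι).summable_iff]
      refine hnorm.congr fun p => ?_
      simp [Fin.consEquiv, Fin.prod_univ_succ]
    · rw [← (Fin.consEquiv fun _ : Fin (d + 1) => ι).hasSum_iff, Fin.prod_univ_succ]
      refine hsum.congr_fun fun p => ?_
      simp [Fin.consEquiv, Fin.prod_univ_succ]

/-- Orthogonality of the characters of `ℤ/nℤ`. -/
theorem sum_range_exp_two_pi_mul_div (n : ℕ) (hn : n ≠ 0) (m : ℤ) :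
    ∑ k ∈ Finset.range n, Complex.exp (2 * Real.pi * Complex.I * (k * m / n)) =
      if (n : ℤ) ∣ m then (n : ℂ) else 0 := by
  have hn' : (n : ℂ) ≠ 0 := Nat.cast_ne_zero.mpr hn
  set ζ := Complex.exp (2 * Real.pi * Complex.I * (m / n)) with hζ
  have hpow (k : ℕ) : Complex.exp (2 * Real.pi * Complex.I * (k * m / n)) = ζ ^ k := by
    rw [hζ, ← Complex.exp_nat_mul]
    ring_nf
  have hone : ζ = 1 ↔ (n : ℤ) ∣ m := by
    rw [hζ, Complex.exp_eq_one_iff]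
    refine exists_congr fun c => ?_
    rw [mul_comm (c : ℂ), mul_right_inj' Complex.two_pi_I_ne_zero, div_eq_iff hn']
    rw [mul_comm]
    exact_mod_cast Iff.rfl
  simp_rw [hpow]
  split_ifs with h
  · simp [hone.mpr h]
  · have hζn : ζ ^ n = 1 := by
      rw [← hpow, Complex.exp_eq_one_iff]
      exact ⟨m, by field_simp⟩
    rw [geom_sum_eq (mt hone.mp h), hζn, sub_self, zero_div]

theorem exp_two_pi_int_mul_fract (h : ℤ) (x : ℝ) :
    Complex.exp (2 * Real.pi * Complex.I * h * (Int.fract x : ℝ)) =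
      Complex.exp (2 * Real.pi * Complex.I * h * x) := by
  rw [Complex.exp_eq_exp_iff_exists_int]
  refine ⟨-(h * ⌊x⌋), ?_⟩
  rw [← Int.self_sub_floor]
  push_cast
  ring

theorem norm_exp_two_pi_int_mul (h : ℤ) (x : ℝ) :
    ‖Complex.exp (2 * Real.pi * Complex.I * h * x)‖ = 1 := by
  rw [show 2 * Real.pi * Complex.I * h * x = ((2 * Real.pi * h * x : ℝ) : ℂ) * Complex.I by
    push_cast; ring]
  exact Complex.norm_exp_ofReal_mul_I _

theorem rAlpha_pos (α : ℝ) (h : ℤ) : 0 < rAlpha α h := by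
  unfold rAlpha
  split_ifs with h0
  · exact one_pos
  · positivity

theorem rAlpha_neg (α : ℝ) (h : ℤ) : rAlpha α (-h) = rAlpha α h := by
  simp [rAlpha]

theorem summable_inv_rAlpha {α : ℝ} (hα : 1 / 2 < α) : Summable fun h : ℤ => (rAlpha α h)⁻¹ := by
  refine (Real.summable_abs_int_rpow (b := 2 * α) (by linarith)).congr_cofinite ?_
  refine (Set.finite_singleton (0 : ℤ)).subset fun h hh => ?_
  by_contra h0
  refine hh ?_
  simp only [Set.mem_singleton_iff] at h0
  simp [rAlpha, h0, Real.rpow_neg]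

/-- The series defining `omegaAlpha`, including its value as a complex number. -/
theorem hasSum_omegaAlpha {α : ℝ} (hα : 1 / 2 < α) (x : ℝ) :
    HasSum (fun h : ℤ => if h = 0 then (0 : ℂ)
      else Complex.exp (2 * (Real.pi : ℂ) * Complex.I * (h : ℂ) * (x : ℂ)) / (rAlpha α h : ℂ))
      (omegaAlpha α x) := by
  set f : ℤ → ℂ := fun h => if h = 0 then (0 : ℂ)
      else Complex.exp (2 * (Real.pi : ℂ) * Complex.I * (h : ℂ) * (x : ℂ)) / (rAlpha α h : ℂ)
    with hf
  have hsum : Summable f := by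
    refine (summable_inv_rAlpha hα).of_norm_bounded fun h => ?_
    have hr := rAlpha_pos α h
    simp only [hf]
    split_ifs with h0
    · simpa using hr.le
    · rw [norm_div, norm_exp_two_pi_int_mul, Complex.norm_real, Real.norm_of_nonneg hr.le, one_div]
  have hconj (h : ℤ) : (starRingEnd ℂ) (f h) = f (-h) := by
    simp only [hf, neg_eq_zero, rAlpha_neg]
    split_ifs with h0
    · simp
    · rw [map_div₀, Complex.conj_ofReal, ← Complex.exp_conj]
      simp [Complex.conj_ofNat]
  have hreal : (starRingEnd ℂ) (∑' h, f h) = ∑' h, f h := by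
    rw [Complex.conj_tsum]
    simp_rw [hconj]
    exact (Equiv.neg ℤ).tsum_eq f
  have homega : (omegaAlpha α x : ℂ) = ∑' h, f h := Complex.conj_eq_iff_re.mp hreal
  rw [homega]
  exact hsum.hasSum

/-- The Fourier coefficient at `h` of `x ↦ b + c * omegaAlpha α x`. -/
noncomputable def korobovCoeff (α b c : ℝ) (h : ℤ) : ℝ :=
  if h = 0 then b else c / rAlpha α h

theorem summable_norm_korobovCoeff {α : ℝ} (hα : 1 / 2 < α) (b c : ℝ) :
    Summable fun h : ℤ => ‖korobovCoeff α b c h‖ := by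
  refine ((summable_inv_rAlpha hα).mul_left c).norm.congr_cofinite ?_
  refine (Set.finite_singleton (0 : ℤ)).subset fun h hh => ?_
  by_contra h0
  refine hh ?_
  simp only [Set.mem_singleton_iff] at h0
  simp [korobovCoeff, h0, div_eq_mul_inv]

theorem hasSum_korobovCoeff_mul_exp {α : ℝ} (hα : 1 / 2 < α) (b c x : ℝ) :
    HasSum (fun h : ℤ => (korobovCoeff α b c h : ℂ) *
      Complex.exp (2 * Real.pi * Complex.I * h * x)) ((b + c * omegaAlpha α x : ℝ) : ℂ) := by
  push_cast
  refine ((hasSum_ite_eq (0 : ℤ) (b : ℂ)).add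
    ((hasSum_omegaAlpha hα x).mul_left (c : ℂ))).congr_fun fun h => ?_
  by_cases h0 : h = 0
  · simp [korobovCoeff, h0]
  · simp [korobovCoeff, h0]
    ring

theorem prod_korobovCoeff {ι : Type*} [Fintype ι] (α : ℝ) (β γ : ι → ℝ) (h : ι → ℤ) :
    ∏ j, korobovCoeff α (β j) (γ j) (h j) =
      (∏ j, rAlpha α (h j))⁻¹ * (∏ j ∈ Finset.univ.filter (fun j => h j ≠ 0), γ j)
        * (∏ j ∈ Finset.univ.filter (fun j => h j = 0), β j) := by
  rw [Finset.prod_filter, Finset.prod_filter, ← Finset.prod_inv_distrib,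
    ← Finset.prod_mul_distrib, ← Finset.prod_mul_distrib]
  refine Finset.prod_congr rfl fun j _ => ?_
  by_cases h0 : h j = 0
  · simp [korobovCoeff, rAlpha, h0]
  · simp [korobovCoeff, h0]
    ring

/-- A rank-1 lattice rule applied to a product of functions `β j + γ j * omegaAlpha α` sums the
Fourier coefficients over the dual lattice. -/
theorem hasSum_dual_lattice {α : ℝ} (hα : 1 / 2 < α) {n : ℕ} (hn : n ≠ 0) {d : ℕ}
    (β γ : Fin d → ℝ) (z : Fin d → ℤ) :
    HasSum (fun h : Fin d → ℤ => if (n : ℤ) ∣ ∑ j, h j * z j then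
        ∏ j, korobovCoeff α (β j) (γ j) (h j) else 0)
      ((1 / (n : ℝ)) * ∑ k ∈ Finset.range n, ∏ j,
        (β j + γ j * omegaAlpha α (Int.fract ((k : ℝ) * (z j : ℝ) / (n : ℝ))))) := by
  have hn' : (n : ℂ) ≠ 0 := Nat.cast_ne_zero.mpr hn
  rw [← Complex.hasSum_ofReal]
  have hpoint (k : ℕ) : HasSum (fun h : Fin d → ℤ =>
      ((∏ j, korobovCoeff α (β j) (γ j) (h j) : ℝ) : ℂ) *
        Complex.exp (2 * Real.pi * Complex.I * (k * (∑ j, h j * z j : ℤ) / n)))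
      ((∏ j, (β j + γ j * omegaAlpha α (Int.fract ((k : ℝ) * (z j : ℝ) / (n : ℝ)))) : ℝ) : ℂ) := by
    have hs (j : Fin d) := hasSum_korobovCoeff_mul_exp hα (β j) (γ j)
      (Int.fract ((k : ℝ) * (z j : ℝ) / (n : ℝ)))
    have hprod := (summable_norm_and_hasSum_prod_pi d
      (fun j h => (korobovCoeff α (β j) (γ j) h : ℂ) * Complex.exp (2 * Real.pi * Complex.I * h *
        (Int.fract ((k : ℝ) * (z j : ℝ) / (n : ℝ)) : ℝ))) fun j => by
        simpa only [norm_mul, norm_exp_two_pi_int_mul, mul_one, Complex.norm_real] using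
          summable_norm_korobovCoeff hα (β j) (γ j)).2
    simp_rw [fun j => (hs j).tsum_eq, ← Complex.ofReal_prod] at hprod
    refine hprod.congr_fun fun h => ?_
    rw [Finset.prod_mul_distrib, Complex.ofReal_prod]
    congr 1
    simp_rw [exp_two_pi_int_mul_fract]
    rw [← Complex.exp_sum]
    congr 1
    push_cast
    simp_rw [Finset.mul_sum, Finset.sum_div, Finset.mul_sum]
    exact Finset.sum_congr rfl fun j _ => by ring
  have hall := (hasSum_sum fun k (_ : k ∈ Finset.range n) => hpoint k).mul_left (1 / (n : ℂ))
  push_cast at hall ⊢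
  refine hall.congr_fun fun h => ?_
  have hchar := sum_range_exp_two_pi_mul_div n hn (∑ j, h j * z j)
  push_cast at hchar
  rw [← Finset.mul_sum, hchar]
  split_ifs
  · push_cast
    field_simp
  · simp

/-- For `α > 1/2`, `n ≥ 1`, `d ≥ 1`, positive weights `β`, `γ`, and `z ∈ ℤ^d`:
`−∏_j β_j + (1/n) ∑_{k<n} ∏_j (β_j + γ_j ω_α({k z_j / n}))`
equals the (convergent) sum over `0 ≠ h ∈ ℤ^d` with `h·z ≡ 0 (mod n)` of
`r_α(h)⁻¹ ∏_{j : h_j ≠ 0} γ_j ∏_{j : h_j = 0} β_j`. -/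
theorem korobov_wce_eq_dual_sum (α : ℝ) (hα : 1 / 2 < α) (n d : ℕ) (hn : 1 ≤ n) (hd : 1 ≤ d)
    (β γ : Fin d → ℝ) (hβ : ∀ j, 0 < β j) (hγ : ∀ j, 0 < γ j) (z : Fin d → ℤ) :
    Summable (fun h : Fin d → ℤ =>
      if h ≠ 0 ∧ (n : ℤ) ∣ ∑ j, h j * z j then
        (∏ j, rAlpha α (h j))⁻¹ * (∏ j ∈ Finset.univ.filter (fun j => h j ≠ 0), γ j)
          * (∏ j ∈ Finset.univ.filter (fun j => h j = 0), β j)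
      else 0) ∧
    - ∏ j, β j + (1 / (n : ℝ)) * ∑ k ∈ Finset.range n, ∏ j,
        (β j + γ j * omegaAlpha α (Int.fract ((k : ℝ) * (z j : ℝ) / (n : ℝ))))
      = ∑' h : Fin d → ℤ,
          if h ≠ 0 ∧ (n : ℤ) ∣ ∑ j, h j * z j then
            (∏ j, rAlpha α (h j))⁻¹ * (∏ j ∈ Finset.univ.filter (fun j => h j ≠ 0), γ j)
              * (∏ j ∈ Finset.univ.filter (fun j => h j = 0), β j)
          else 0 := by
  have hdual := hasSum_dual_lattice hα (Nat.one_le_iff_ne_zero.mp hn) β γ z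
  have hzero := hasSum_ite_eq (0 : Fin d → ℤ) (-∏ j, β j)
  have hmain := (hzero.add hdual)
  suffices hsum : HasSum _ _ from ⟨hsum.summable, hsum.tsum_eq.symm⟩
  refine hmain.congr_fun fun h => ?_
  rw [← prod_korobovCoeff]
  by_cases h0 : h = 0
  · simp [h0, korobovCoeff]
  · simp [h0]
end

section
/- Let n be a prime number, d ≥ 1, α > 1/2, let β_1,…,β_d and γ_1,…,γ_d be positive reals, let z⁰ ∈ {0,…,n−1}^d be an arbitrary initial vector, and let z* ∈ {0,…,n−1}^d be an output of the successive coordinate search algorithm started from z⁰ (with respect to the Korobov squared worst-case error e²_{n,d}). Then for every λ with 1 ≤ λ < 2α, e²_{n,d}(z*) ≤ C_{d,λ} · n^{−λ}, where C_{d,λ} = 2^λ · ( Σ_{j=1}^d (γ_j/β_j)^{1/λ} )^λ · ∏_{j=1}^d ( β_j^{1/λ} + γ_j^{1/λ} μ_{α,λ} )^λ · μ_{α,λ}^λ · max_{s=1,…,d} ( 1 + (γ_s/β_s)^{1/λ} μ_{α,λ} )^{−λ} and μ_{α,λ} = 2 ζ(2α/λ) with ζ the Riemann zeta function. -/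
/-- The squared worst-case error of the `n`-point rank-1 lattice rule with generating vector
`z ∈ {0,…,n−1}^d` in the weighted Korobov space with smoothness `α` and weights `β`, `γ`:
the sum over `0 ≠ h ∈ ℤ^d` with `h·z ≡ 0 (mod n)` of
`r_α(h)⁻¹ ∏_{j : h_j ≠ 0} γ_j ∏_{j : h_j = 0} β_j`. -/
noncomputable def e2Kor (n d : ℕ) (α : ℝ) (β γ : Fin d → ℝ) (z : Fin d → ℕ) : ℝ :=
  ∑' h : Fin d → ℤ,
    if h ≠ 0 ∧ (n : ℤ) ∣ ∑ j, h j * (z j : ℤ) then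
      (∏ j, rAlpha α (h j))⁻¹ * (∏ j ∈ Finset.univ.filter (fun j => h j ≠ 0), γ j)
        * (∏ j ∈ Finset.univ.filter (fun j => h j = 0), β j)
    else 0

/-- `μ_{α,λ} = 2 ζ(2α/λ)` (real part of the Riemann zeta function at the real point `2α/λ`). -/
noncomputable def muAL (α lam : ℝ) : ℝ := 2 * (riemannZeta ((2 * α / lam : ℝ) : ℂ)).re

open scoped ENNReal

namespace KorobovSCS

/-- In `ℝ≥0∞`, sums over `Fin d → ι` of products factor. -/
theorem tsum_pi_prod {ι : Type*} {d : ℕ} (f : Fin d → ι → ℝ≥0∞) :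
    ∑' h : Fin d → ι, ∏ j, f j (h j) = ∏ j, ∑' k, f j k := by
  induction d with
  | zero => simp
  | succ d ih =>
    rw [← (Fin.consEquiv fun _ : Fin (d + 1) => ι).tsum_eq, ENNReal.tsum_prod', Fin.prod_univ_succ,
      ← ih, ← ENNReal.tsum_mul_right]
    refine tsum_congr fun a => ?_
    rw [← ENNReal.tsum_mul_left]
    exact tsum_congr fun b => by simp [Fin.consEquiv, Fin.prod_univ_succ]

theorem finsetSum_rpow_le {ι : Type*} (s : Finset ι) (f : ι → ℝ≥0∞) {q : ℝ} (hq : 0 < q)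
    (hq1 : q ≤ 1) : (∑ i ∈ s, f i) ^ q ≤ ∑ i ∈ s, f i ^ q :=
  Finset.le_sum_of_subadditive (fun x : ℝ≥0∞ => x ^ q) (ENNReal.zero_rpow_of_pos hq).le
    (fun a b => ENNReal.rpow_add_le_add_rpow a b hq.le hq1) s f

theorem tsum_rpow_le {ι : Type*} (f : ι → ℝ≥0∞) {q : ℝ} (hq : 0 < q) (hq1 : q ≤ 1) :
    (∑' i, f i) ^ q ≤ ∑' i, f i ^ q := by
  rw [← ENNReal.le_rpow_inv_iff hq, ENNReal.tsum_eq_iSup_sum]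
  refine iSup_le fun s => ?_
  rw [ENNReal.le_rpow_inv_iff hq]
  exact (finsetSum_rpow_le s f hq hq1).trans (ENNReal.sum_le_tsum s)

/-- The `k`-th summand of `2 ζ(p) = ∑_{k ≠ 0} |k|^{-p}`. -/
noncomputable def absPow (p : ℝ) (k : ℤ) : ℝ≥0∞ :=
  if k = 0 then 0 else ENNReal.ofReal (|(k : ℝ)| ^ (-p))

theorem zeta_re_eq_tsum {p : ℝ} (hp : 1 < p) :
    (riemannZeta (p : ℂ)).re = ∑' m : ℕ, ((m : ℝ) + 1) ^ (-p) := by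
  rw [zeta_eq_tsum_one_div_nat_add_one_cpow (by simpa using hp)]
  have : ∀ m : ℕ, 1 / ((m : ℂ) + 1) ^ (p : ℂ) = (((m : ℝ) + 1) ^ (-p) : ℝ) := fun m => by
    rw [Real.rpow_neg (by positivity), Complex.ofReal_inv, Complex.ofReal_cpow (by positivity)]
    simp
  simp_rw [this]
  rw [← Complex.ofReal_tsum, Complex.ofReal_re]

theorem tsum_absPow {p : ℝ} (hp : 1 < p) :
    ∑' k, absPow p k = ENNReal.ofReal (2 * (riemannZeta (p : ℂ)).re) := by
  have hs : Summable fun m : ℕ => ((m : ℝ) + 1) ^ (-p) := by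
    simpa using (summable_nat_add_iff 1).2 (Real.summable_nat_rpow.2 (neg_lt_neg hp))
  rw [tsum_of_add_one_of_neg_add_one ENNReal.summable ENNReal.summable, zeta_re_eq_tsum hp,
    ENNReal.ofReal_mul two_pos.le, ENNReal.ofReal_tsum_of_nonneg (fun _ => by positivity) hs]
  have h1 : ∀ m : ℕ, absPow p ((m : ℤ) + 1) = ENNReal.ofReal (((m : ℝ) + 1) ^ (-p)) := fun m => by
    rw [absPow, if_neg (by omega)]
    push_cast
    rw [abs_of_nonneg (by positivity)]
  have h2 : ∀ m : ℕ, absPow p (-((m : ℤ) + 1)) = ENNReal.ofReal (((m : ℝ) + 1) ^ (-p)) :=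
    fun m => by
      rw [absPow, if_neg (by omega)]
      push_cast
      rw [abs_neg, abs_of_nonneg (by positivity)]
  simp_rw [h1, h2]
  simp [absPow, two_mul]

theorem tsum_absPow_multiples {n : ℕ} (hn : 0 < n) (p : ℝ) :
    ∑' k : ℤ, (if (n : ℤ) ∣ k then absPow p k else 0)
      = ENNReal.ofReal ((n : ℝ) ^ (-p)) * ∑' k, absPow p k := by
  have hn' : (n : ℤ) ≠ 0 := by exact_mod_cast hn.ne'
  rw [← (mul_right_injective₀ hn').tsum_eq, ← ENNReal.tsum_mul_left]
  · refine tsum_congr fun k => ?_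
    rw [if_pos (dvd_mul_right _ _), absPow, absPow]
    by_cases hk : k = 0
    · simp [hk]
    · rw [if_neg (mul_ne_zero hn' hk), if_neg hk, ← ENNReal.ofReal_mul (by positivity)]
      push_cast
      rw [abs_mul, Real.mul_rpow (abs_nonneg _) (abs_nonneg _), Nat.abs_cast]
  · intro k hk
    by_cases h : (n : ℤ) ∣ k
    · obtain ⟨m, rfl⟩ := h
      exact ⟨m, rfl⟩
    · simp [h] at hk

/-- Counting factor for the solutions `w < n` of `n ∣ k w + R`. -/
noncomputable def solBound (n : ℕ) (k : ℤ) : ℝ≥0∞ := if (n : ℤ) ∣ k then n else 1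

theorem sum_dvd_le {n : ℕ} (hn : n.Prime) (k R : ℤ) :
    ∑ w ∈ Finset.range n, (if (n : ℤ) ∣ k * w + R then (1 : ℝ≥0∞) else 0) ≤ solBound n k := by
  rw [Finset.sum_boole, solBound]
  split_ifs with hk
  · exact_mod_cast (Finset.card_filter_le _ _).trans (Finset.card_range n).le
  · have : (Finset.filter (fun w : ℕ => (n : ℤ) ∣ k * w + R) (Finset.range n)).card ≤ 1 := by
      rw [Finset.card_le_one]
      intro a ha b hb
      simp only [Finset.mem_filter, Finset.mem_range] at ha hb
      have h : (n : ℤ) ∣ k * ((a : ℤ) - b) := by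
        have := dvd_sub ha.2 hb.2
        rwa [add_sub_add_right_eq_sub, ← mul_sub] at this
      have h' := ((Nat.prime_iff_prime_int.1 hn).dvd_or_dvd h).resolve_left hk
      have := Int.eq_zero_of_abs_lt_dvd h' (by rw [abs_lt]; omega)
      omega
    exact_mod_cast this

theorem tsum_solBound_mul_absPow_le {n : ℕ} (hn : 0 < n) {p : ℝ} (hp : 1 ≤ p) :
    ∑' k, solBound n k * absPow p k ≤ 2 * ∑' k, absPow p k := by
  have h : ∀ k, solBound n k * absPow p k
      ≤ absPow p k + n * (if (n : ℤ) ∣ k then absPow p k else 0) := fun k => by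
    unfold solBound
    split_ifs <;> simp
  refine (ENNReal.tsum_le_tsum h).trans ?_
  rw [ENNReal.tsum_add, ENNReal.tsum_mul_left, tsum_absPow_multiples hn, ← mul_assoc, two_mul]
  gcongr
  refine mul_le_of_le_one_left' ?_
  rw [← ENNReal.ofReal_natCast, ← ENNReal.ofReal_mul (by positivity), ENNReal.ofReal_le_one]
  have hn1 : (1 : ℝ) ≤ n := by exact_mod_cast hn
  calc (n : ℝ) * (n : ℝ) ^ (-p) = (n : ℝ) ^ (1 + -p) := by
        rw [Real.rpow_add (by positivity), Real.rpow_one]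
    _ ≤ 1 := Real.rpow_le_one_of_one_le_of_nonpos hn1 (by linarith)

/-- The sum of `∏ j, f j (h j)` over the nonzero `h` in the dual lattice of `z`. -/
noncomputable def dualSum (n : ℕ) {d : ℕ} (f : Fin d → ℤ → ℝ≥0∞) (z : Fin d → ℕ) : ℝ≥0∞ :=
  ∑' h : Fin d → ℤ, if h ≠ 0 ∧ (n : ℤ) ∣ ∑ j, h j * (z j : ℤ) then ∏ j, f j (h j) else 0

/-- The part of `dualSum` with `h s ≠ 0`. -/
noncomputable def activePart (n : ℕ) {d : ℕ} (f : Fin d → ℤ → ℝ≥0∞) (s : Fin d)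
    (z : Fin d → ℕ) : ℝ≥0∞ :=
  ∑' h : Fin d → ℤ, if h s ≠ 0 ∧ (n : ℤ) ∣ ∑ j, h j * (z j : ℤ) then ∏ j, f j (h j) else 0

/-- The part of `dualSum` with `h s = 0`. -/
noncomputable def inactivePart (n : ℕ) {d : ℕ} (f : Fin d → ℤ → ℝ≥0∞) (s : Fin d)
    (z : Fin d → ℕ) : ℝ≥0∞ :=
  ∑' h : Fin d → ℤ, if (h ≠ 0 ∧ h s = 0) ∧ (n : ℤ) ∣ ∑ j, h j * (z j : ℤ)
    then ∏ j, f j (h j) else 0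

section

variable {n d : ℕ} {f : Fin d → ℤ → ℝ≥0∞}

theorem inactivePart_add_activePart (s : Fin d) (z : Fin d → ℕ) :
    inactivePart n f s z + activePart n f s z = dualSum n f z := by
  rw [inactivePart, activePart, dualSum, ← ENNReal.tsum_add]
  refine tsum_congr fun h => ?_
  by_cases hs : h s = 0
  · simp [hs]
  · have : h ≠ 0 := fun h0 => hs (by simp [h0])
    simp [hs, this]

theorem inactivePart_congr {s : Fin d} {z z' : Fin d → ℕ} (hz : ∀ j ≠ s, z j = z' j) :
    inactivePart n f s z = inactivePart n f s z' := by
  refine tsum_congr fun h => ?_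
  by_cases hs : h s = 0
  · have : ∑ j, h j * (z j : ℤ) = ∑ j, h j * (z' j : ℤ) :=
      Finset.sum_congr rfl fun j _ => by
        by_cases hj : j = s
        · simp [hj, hs]
        · rw [hz j hj]
    rw [this]
  · simp [hs]

theorem dualSum_le_prod (z : Fin d → ℕ) : dualSum n f z ≤ ∏ j, ∑' k, f j k := by
  rw [← tsum_pi_prod]
  refine ENNReal.tsum_le_tsum fun h => ?_
  split_ifs <;> simp

/-- Group the nonzero `h` by the index of their last nonzero component. -/
theorem dualSum_le_sum_activePart {z : Fin d → ℕ} {y : Fin d → Fin d → ℕ}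
    (hy : ∀ s, ∀ j ≤ s, y s j = z j) :
    dualSum n f z ≤ ∑ s, activePart n f s (y s) := by
  simp only [dualSum, activePart]
  rw [← Summable.tsum_finsetSum fun _ _ => ENNReal.summable]
  refine ENNReal.tsum_le_tsum fun h => ?_
  split_ifs with hh
  · obtain ⟨h0, hdvd⟩ := hh
    obtain ⟨i, hi⟩ := Function.ne_iff.1 h0
    have hne : (Finset.univ.filter fun j => h j ≠ 0).Nonempty := ⟨i, by simpa using hi⟩
    set s := (Finset.univ.filter fun j => h j ≠ 0).max' hne
    have hsmem : h s ≠ 0 := (Finset.mem_filter.1 (Finset.max'_mem _ hne)).2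
    have hlast : ∀ j, s < j → h j = 0 := fun j hj => by
      by_contra hj0
      exact hj.not_ge (Finset.le_max' _ j (by simpa using hj0))
    have hsum : ∑ j, h j * (y s j : ℤ) = ∑ j, h j * (z j : ℤ) :=
      Finset.sum_congr rfl fun j _ => by
        rcases le_or_gt j s with hj | hj
        · rw [hy s j hj]
        · simp [hlast j hj]
    refine le_trans ?_ (Finset.single_le_sum (fun _ _ => zero_le) (Finset.mem_univ s))
    rw [if_pos ⟨hsmem, hsum ▸ hdvd⟩]
  · exact zero_le

/-- Averaging over the `s`-th component of the generating vector. -/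
theorem mul_activePart_rpow_le (hn : n.Prime) {q : ℝ} (hq : 0 < q) (hq1 : q ≤ 1) {s : Fin d}
    {z : Fin d → ℕ}
    (hz : ∀ w < n, activePart n f s z ≤ activePart n f s (Function.update z s w)) :
    n * activePart n f s z ^ q ≤
      (∑' k, solBound n k * (if k = 0 then 0 else f s k ^ q))
        * ∏ j ∈ Finset.univ.erase s, ∑' k, f j k ^ q := by
  set g : Fin d → ℤ → ℝ≥0∞ := fun j k =>
    if j = s then solBound n k * (if k = 0 then 0 else f s k ^ q) else f j k ^ q with hg
  have hR : (∑' k, solBound n k * (if k = 0 then 0 else f s k ^ q))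
        * ∏ j ∈ Finset.univ.erase s, ∑' k, f j k ^ q = ∑' h : Fin d → ℤ, ∏ j, g j (h j) := by
    rw [tsum_pi_prod, ← Finset.mul_prod_erase _ _ (Finset.mem_univ s)]
    congr 1
    · simp [hg]
    · exact Finset.prod_congr rfl fun j hj => by simp [hg, Finset.ne_of_mem_erase hj]
  rw [hR]
  calc n * activePart n f s z ^ q
      = ∑ w ∈ Finset.range n, activePart n f s z ^ q := by simp
    _ ≤ ∑ w ∈ Finset.range n, activePart n f s (Function.update z s w) ^ q :=
        Finset.sum_le_sum fun w hw =>
          ENNReal.rpow_le_rpow (hz w (Finset.mem_range.1 hw)) hq.le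
    _ ≤ ∑ w ∈ Finset.range n, ∑' h : Fin d → ℤ,
          (if h s ≠ 0 ∧ (n : ℤ) ∣ ∑ j, h j * (Function.update z s w j : ℤ)
            then ∏ j, f j (h j) else 0) ^ q :=
        Finset.sum_le_sum fun w _ => tsum_rpow_le _ hq hq1
    _ = ∑' h : Fin d → ℤ, ∑ w ∈ Finset.range n,
          (if h s ≠ 0 ∧ (n : ℤ) ∣ ∑ j, h j * (Function.update z s w j : ℤ)
            then ∏ j, f j (h j) else 0) ^ q :=
        (Summable.tsum_finsetSum fun _ _ => ENNReal.summable).symm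
    _ ≤ ∑' h : Fin d → ℤ, ∏ j, g j (h j) := ENNReal.tsum_le_tsum fun h => ?_
  by_cases hs : h s = 0
  · simp [hs, ENNReal.zero_rpow_of_pos hq]
  have hdot : ∀ w : ℕ, ∑ j, h j * (Function.update z s w j : ℤ)
      = h s * w + ∑ j ∈ Finset.univ.erase s, h j * (z j : ℤ) := fun w => by
    rw [← Finset.add_sum_erase _ _ (Finset.mem_univ s)]
    congr 1
    · simp
    · exact Finset.sum_congr rfl fun j hj => by
        rw [Function.update_of_ne (Finset.ne_of_mem_erase hj)]
  have hprod : ∏ j, g j (h j) = solBound n (h s) * ∏ j, f j (h j) ^ q := by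
    rw [← Finset.mul_prod_erase _ _ (Finset.mem_univ s),
      ← Finset.mul_prod_erase _ (fun j => f j (h j) ^ q) (Finset.mem_univ s), ← mul_assoc]
    congr 1
    · simp [hg, hs]
    · exact Finset.prod_congr rfl fun j hj => by simp [hg, Finset.ne_of_mem_erase hj]
  rw [hprod]
  refine le_trans (le_of_eq ?_) (mul_le_mul_left
    (sum_dvd_le hn (h s) (∑ j ∈ Finset.univ.erase s, h j * (z j : ℤ))) (∏ j, f j (h j) ^ q))
  rw [Finset.sum_mul]
  refine Finset.sum_congr rfl fun w _ => ?_
  rw [hdot]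
  split_ifs with h1 h2 h2
  · rw [one_mul, ENNReal.prod_rpow_of_nonneg hq.le]
  · exact absurd h1.2 h2
  · exact absurd ⟨hs, h2⟩ h1
  · rw [zero_mul, ENNReal.zero_rpow_of_pos hq]

end

/-- The one-dimensional weight `b` at `0` and `g |k|^{-2α}` at `k ≠ 0`. -/
noncomputable def korobovWeight (α b g : ℝ) (k : ℤ) : ℝ≥0∞ :=
  if k = 0 then ENNReal.ofReal b else ENNReal.ofReal g * absPow (2 * α) k

theorem absPow_rpow (p : ℝ) (k : ℤ) {q : ℝ} (hq : 0 < q) : absPow p k ^ q = absPow (p * q) k := by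
  unfold absPow
  split_ifs
  · exact ENNReal.zero_rpow_of_pos hq
  · rw [ENNReal.ofReal_rpow_of_nonneg (by positivity) hq.le, ← Real.rpow_mul (abs_nonneg _),
      neg_mul]

theorem korobovWeight_ne_top (α b g : ℝ) (k : ℤ) : korobovWeight α b g k ≠ ∞ := by
  unfold korobovWeight absPow
  split_ifs
  · exact ENNReal.ofReal_ne_top
  · exact ENNReal.mul_ne_top ENNReal.ofReal_ne_top ENNReal.ofReal_ne_top

theorem ite_korobovWeight_rpow (α b : ℝ) {g : ℝ} (hg : 0 ≤ g) (k : ℤ) {q : ℝ} (hq : 0 < q) :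
    (if k = 0 then 0 else korobovWeight α b g k ^ q)
      = ENNReal.ofReal (g ^ q) * absPow (2 * α * q) k := by
  by_cases hk : k = 0
  · simp [hk, absPow]
  · rw [if_neg hk, korobovWeight, if_neg hk, ENNReal.mul_rpow_of_nonneg _ _ hq.le,
      absPow_rpow _ _ hq, ENNReal.ofReal_rpow_of_nonneg hg hq.le]

theorem tsum_korobovWeight_rpow {α b g q : ℝ} (hb : 0 ≤ b) (hg : 0 ≤ g) (hq : 0 < q)
    (hp : 1 < 2 * α * q) :
    ∑' k, korobovWeight α b g k ^ q = ENNReal.ofReal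
      (b ^ q + g ^ q * (2 * (riemannZeta ((2 * α * q : ℝ) : ℂ)).re)) := by
  have hz : 0 ≤ (riemannZeta ((2 * α * q : ℝ) : ℂ)).re := by
    rw [zeta_re_eq_tsum hp]
    exact tsum_nonneg fun _ => by positivity
  have hsplit : ∑' k, korobovWeight α b g k ^ q = korobovWeight α b g 0 ^ q
      + ∑' k : ℤ, if k = 0 then 0 else korobovWeight α b g k ^ q := by
    convert ENNReal.tsum_eq_add_tsum_ite (f := fun k => korobovWeight α b g k ^ q) 0
  rw [hsplit, tsum_congr fun k => ite_korobovWeight_rpow α b hg k hq]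
  rw [ENNReal.tsum_mul_left, tsum_absPow hp, korobovWeight, if_pos rfl,
    ENNReal.ofReal_rpow_of_nonneg hb hq.le, ← ENNReal.ofReal_mul (by positivity),
    ← ENNReal.ofReal_add (by positivity) (by positivity)]

theorem e2Kor_eq_toReal (n d : ℕ) (α : ℝ) {β γ : Fin d → ℝ} (hβ : ∀ j, 0 < β j)
    (hγ : ∀ j, 0 < γ j) (z : Fin d → ℕ) :
    e2Kor n d α β γ z
      = (dualSum n (fun j => korobovWeight α (β j) (γ j)) z).toReal := by
  rw [e2Kor, dualSum, ENNReal.tsum_toReal_eq fun h => by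
    split_ifs
    · exact ENNReal.prod_ne_top fun j _ => korobovWeight_ne_top _ _ _ _
    · exact ENNReal.zero_ne_top]
  refine tsum_congr fun h => ?_
  split_ifs
  · rw [ENNReal.toReal_prod, Finset.prod_filter, Finset.prod_filter, ← Finset.prod_inv_distrib,
      ← Finset.prod_mul_distrib, ← Finset.prod_mul_distrib]
    refine Finset.prod_congr rfl fun j _ => ?_
    by_cases hj : h j = 0
    · simp [hj, rAlpha, korobovWeight, (hβ j).le]
    · simp only [hj, rAlpha, korobovWeight, absPow, if_false, not_false_eq_true, ne_eq, if_true,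
        ENNReal.toReal_mul, mul_one]
      rw [ENNReal.toReal_ofReal (hγ j).le, ENNReal.toReal_ofReal (by positivity),
        Real.rpow_neg (abs_nonneg _), mul_comm]
  · rfl

/-- Each step of the search makes its active part as small as the average over all candidates. -/
theorem activePart_toReal_le {n : ℕ} (hn : n.Prime) {d : ℕ} {α : ℝ} {β γ : Fin d → ℝ}
    (hβ : ∀ j, 0 < β j) (hγ : ∀ j, 0 < γ j) {lam : ℝ} (hlam1 : 1 ≤ lam) (hlam2 : lam < 2 * α)
    {s : Fin d} {z : Fin d → ℕ}
    (hz : ∀ w < n, activePart n (fun j => korobovWeight α (β j) (γ j)) s z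
      ≤ activePart n (fun j => korobovWeight α (β j) (γ j)) s (Function.update z s w)) :
    activePart n (fun j => korobovWeight α (β j) (γ j)) s z ≤ ENNReal.ofReal
      ((γ s ^ (1 / lam) * (2 * muAL α lam) *
        (∏ j ∈ Finset.univ.erase s, (β j ^ (1 / lam) + γ j ^ (1 / lam) * muAL α lam)) / n)
          ^ lam) := by
  have hlam0 : 0 < lam := by linarith
  have hq : 0 < 1 / lam := by positivity
  have hq1 : 1 / lam ≤ 1 := (div_le_one hlam0).2 hlam1
  have hp : 1 < 2 * α * (1 / lam) := by rw [mul_one_div, one_lt_div hlam0]; exact hlam2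
  have hmu : muAL α lam = 2 * (riemannZeta ((2 * α * (1 / lam) : ℝ) : ℂ)).re := by
    rw [muAL, mul_one_div]
  have hmu0 : 0 ≤ muAL α lam := by
    rw [hmu, zeta_re_eq_tsum hp]
    exact mul_nonneg two_pos.le (tsum_nonneg fun _ => by positivity)
  have hn0 : (0 : ℝ) < n := by exact_mod_cast hn.pos
  have key := mul_activePart_rpow_le hn hq hq1 hz
  have hfac : ∀ j, 0 ≤ β j ^ (1 / lam) + γ j ^ (1 / lam) * muAL α lam := fun j => by
    have := hβ j
    have := hγ j
    positivity
  have hγs : 0 ≤ γ s ^ (1 / lam) := Real.rpow_nonneg (hγ s).le _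
  simp_rw [ite_korobovWeight_rpow α _ (hγ _).le _ hq,
    tsum_korobovWeight_rpow (hβ _).le (hγ _).le hq hp, ← hmu] at key
  rw [← ENNReal.ofReal_prod_of_nonneg fun j _ => hfac j] at key
  have hsol : ∑' k, solBound n k * (ENNReal.ofReal (γ s ^ (1 / lam)) *
      absPow (2 * α * (1 / lam)) k) ≤ ENNReal.ofReal (γ s ^ (1 / lam) * (2 * muAL α lam)) := by
    simp_rw [mul_left_comm (solBound n _)]
    rw [ENNReal.tsum_mul_left, ENNReal.ofReal_mul hγs, ENNReal.ofReal_mul two_pos.le, hmu,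
      ← tsum_absPow hp, ENNReal.ofReal_ofNat]
    gcongr
    exact tsum_solBound_mul_absPow_le hn.pos hp.le
  replace key := key.trans (mul_le_mul_left hsol _)
  rw [← ENNReal.ofReal_mul (by positivity)] at key
  have hP := Finset.prod_nonneg fun j (_ : j ∈ Finset.univ.erase s) => hfac j
  rw [← ENNReal.ofReal_rpow_of_nonneg (by positivity) hlam0.le]
  rw [← ENNReal.rpow_inv_le_iff hlam0, ENNReal.ofReal_div_of_pos hn0, ENNReal.ofReal_natCast,
    ENNReal.le_div_iff_mul_le (Or.inl (by exact_mod_cast hn.ne_zero))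
      (Or.inl (ENNReal.natCast_ne_top n)), mul_comm, ← one_div]
  exact key

end KorobovSCS

open KorobovSCS in
/-- Error bound for the SCS algorithm in the weighted Korobov space: for prime `n`, any initial
vector `z⁰` and any SCS output `z*`, and any `1 ≤ λ < 2α`,
`e²_{n,d}(z*) ≤ C_{d,λ} n^{−λ}` with
`C_{d,λ} = 2^λ (∑_j (γ_j/β_j)^{1/λ})^λ ∏_j (β_j^{1/λ} + γ_j^{1/λ} μ_{α,λ})^λ μ_{α,λ}^λ
  · max_s (1 + (γ_s/β_s)^{1/λ} μ_{α,λ})^{−λ}`. -/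
theorem scs_korobov_error_bound (n : ℕ) (hn : n.Prime) (d : ℕ) (hd : 1 ≤ d)
    (α : ℝ) (hα : 1 / 2 < α)
    (β γ : Fin d → ℝ) (hβ : ∀ j, 0 < β j) (hγ : ∀ j, 0 < γ j)
    (z0 zstar : Fin d → ℕ) (hz0 : ∀ j, z0 j < n) (hzstar : ∀ j, zstar j < n)
    (hscs : ∀ s : Fin d, ∀ w < n,
      e2Kor n d α β γ (fun j => if j ≤ s then zstar j else z0 j)
        ≤ e2Kor n d α β γ (fun j => if j < s then zstar j else if j = s then w else z0 j))
    (lam : ℝ) (hlam1 : 1 ≤ lam) (hlam2 : lam < 2 * α) :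
    e2Kor n d α β γ zstar
      ≤ (2 ^ lam * (∑ j, (γ j / β j) ^ (1 / lam)) ^ lam
          * (∏ j, (β j ^ (1 / lam) + γ j ^ (1 / lam) * muAL α lam) ^ lam)
          * muAL α lam ^ lam
          * Finset.univ.sup' (Finset.univ_nonempty_iff.mpr ⟨⟨0, hd⟩⟩)
              (fun s => (1 + (γ s / β s) ^ (1 / lam) * muAL α lam) ^ (-lam)))
        * (n : ℝ) ^ (-lam) := by
  have hlam0 : 0 < lam := by linarith
  have hq : 0 < 1 / lam := by positivity
  set f : Fin d → ℤ → ENNReal := fun j => korobovWeight α (β j) (γ j) with hf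
  set y : Fin d → Fin d → ℕ := fun s j => if j ≤ s then zstar j else z0 j with hy
  have hfin : ∀ z, dualSum n f z ≠ ⊤ := fun z => by
    refine ne_top_of_le_ne_top (ENNReal.prod_ne_top fun j _ => ?_) (dualSum_le_prod z)
    have := tsum_korobovWeight_rpow (hβ j).le (hγ j).le one_pos
      (show 1 < 2 * α * 1 by linarith)
    simp only [ENNReal.rpow_one] at this
    rw [hf, this]
    exact ENNReal.ofReal_ne_top
  have hstep : ∀ s, ∀ w < n,
      activePart n f s (y s) ≤ activePart n f s (Function.update (y s) s w) := fun s w hw => by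
    have h := hscs s w hw
    have hupd : (fun j => if j < s then zstar j else if j = s then w else z0 j)
        = Function.update (y s) s w := by
      ext j
      rcases lt_trichotomy j s with hj | rfl | hj
      · simp [hy, hj, hj.le, hj.ne]
      · simp
      · simp [hy, hj.not_gt, hj.not_ge, hj.ne']
    rw [hupd, e2Kor_eq_toReal n d α hβ hγ, e2Kor_eq_toReal n d α hβ hγ,
      ENNReal.toReal_le_toReal (hfin _) (hfin _), ← inactivePart_add_activePart s,
      ← inactivePart_add_activePart s (Function.update (y s) s w),
      ← inactivePart_congr fun j hj => (Function.update_of_ne hj w (y s)).symm] at h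
    refine (ENNReal.add_le_add_iff_left (ne_top_of_le_ne_top (hfin (y s)) ?_)).1 h
    rw [← inactivePart_add_activePart s]
    exact le_self_add
  have hmu0 : 0 ≤ muAL α lam := by
    rw [muAL, zeta_re_eq_tsum ((one_lt_div hlam0).2 hlam2)]
    exact mul_nonneg two_pos.le (tsum_nonneg fun _ => by positivity)
  have hn0 : (0 : ℝ) < n := by exact_mod_cast hn.pos
  set b : Fin d → ℝ := fun j => β j ^ (1 / lam) + γ j ^ (1 / lam) * muAL α lam with hb
  have hb0 : ∀ j, 0 < b j := fun j =>
    add_pos_of_pos_of_nonneg (Real.rpow_pos_of_pos (hβ j) _)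
      (mul_nonneg (Real.rpow_nonneg (hγ j).le _) hmu0)
  set M := Finset.univ.sup' (Finset.univ_nonempty_iff.mpr ⟨⟨0, hd⟩⟩)
    (fun s => (1 + (γ s / β s) ^ (1 / lam) * muAL α lam) ^ (-lam))
  set C := 2 ^ lam * (∏ j, b j ^ lam) * muAL α lam ^ lam * M * (n : ℝ) ^ (-lam) with hC
  have hr0 : ∀ s, 0 < γ s / β s := fun s => div_pos (hγ s) (hβ s)
  have hD0 : ∀ s, 0 < 1 + (γ s / β s) ^ (1 / lam) * muAL α lam := fun s =>
    add_pos_of_pos_of_nonneg one_pos (mul_nonneg (Real.rpow_nonneg (hr0 s).le _) hmu0)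
  have hterm : ∀ s, activePart n f s (y s) ≤ ENNReal.ofReal (γ s / β s * C) := fun s => by
    refine (activePart_toReal_le hn hβ hγ hlam1 hlam2 (hstep s)).trans
      (ENNReal.ofReal_le_ofReal ?_)
    have hsM : (1 + (γ s / β s) ^ (1 / lam) * muAL α lam) ^ (-lam) ≤ M :=
      Finset.le_sup' (fun s => (1 + (γ s / β s) ^ (1 / lam) * muAL α lam) ^ (-lam))
        (Finset.mem_univ s)
    have hbs : b s = β s ^ (1 / lam) * (1 + (γ s / β s) ^ (1 / lam) * muAL α lam) := by
      have := Real.rpow_pos_of_pos (hβ s) (1 / lam)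
      rw [Real.div_rpow (hγ s).le (hβ s).le]
      simp only [hb]
      field_simp
    have hprod : ∏ j ∈ Finset.univ.erase s, b j = (∏ j, b j) / b s := by
      rw [← Finset.mul_prod_erase _ _ (Finset.mem_univ s), mul_div_cancel_left₀ _ (hb0 s).ne']
    have hP0 : 0 ≤ ∏ j, b j := Finset.prod_nonneg fun j _ => (hb0 j).le
    have hg0 := Real.rpow_nonneg (hγ s).le (1 / lam)
    have hroot : ∀ x : ℝ, 0 ≤ x → (x ^ (1 / lam)) ^ lam = x := fun x hx => by
      rw [← Real.rpow_mul hx, one_div_mul_cancel hlam0.ne', Real.rpow_one]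
    calc (γ s ^ (1 / lam) * (2 * muAL α lam) * (∏ j ∈ Finset.univ.erase s, b j) / n) ^ lam
        = γ s / β s * (2 ^ lam * (∏ j, b j ^ lam) * muAL α lam ^ lam
            * (1 + (γ s / β s) ^ (1 / lam) * muAL α lam) ^ (-lam) * (n : ℝ) ^ (-lam)) := by
          rw [hprod, Real.div_rpow (by have := (hb0 s).le; positivity) hn0.le,
            Real.mul_rpow (by positivity) (div_nonneg hP0 (hb0 s).le),
            Real.mul_rpow hg0 (by positivity), Real.mul_rpow two_pos.le hmu0,
            Real.div_rpow hP0 (hb0 s).le, hroot _ (hγ s).le, hbs,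
            Real.mul_rpow (Real.rpow_nonneg (hβ s).le _) (hD0 s).le, hroot _ (hβ s).le,
            Real.finsetProd_rpow _ _ fun j _ => (hb0 j).le,
            Real.rpow_neg (hD0 s).le, Real.rpow_neg hn0.le]
          have := hβ s
          have := Real.rpow_pos_of_pos (hD0 s) lam
          field_simp
      _ ≤ γ s / β s * C := by
          have := (hr0 s).le
          have : 0 ≤ ∏ j, b j ^ lam := Finset.prod_nonneg fun j _ => Real.rpow_nonneg (hb0 j).le _
          rw [hC]
          gcongr
  have hM0 : 0 ≤ M := (Real.rpow_nonneg (hD0 ⟨0, hd⟩).le _).trans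
    (Finset.le_sup' (fun s => (1 + (γ s / β s) ^ (1 / lam) * muAL α lam) ^ (-lam))
      (Finset.mem_univ ⟨0, hd⟩))
  have hC0 : 0 ≤ C := by
    have : 0 ≤ ∏ j, b j ^ lam := Finset.prod_nonneg fun j _ => Real.rpow_nonneg (hb0 j).le _
    positivity
  have hsum : ∑ s, γ s / β s ≤ (∑ s, (γ s / β s) ^ (1 / lam)) ^ lam := by
    have h := finsetSum_rpow_le Finset.univ (fun s => ENNReal.ofReal (γ s / β s)) hq
      ((div_le_one hlam0).2 hlam1)
    simp_rw [fun s => ENNReal.ofReal_rpow_of_nonneg (hr0 s).le hq.le] at h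
    rw [← ENNReal.ofReal_sum_of_nonneg fun s _ => (hr0 s).le,
      ← ENNReal.ofReal_sum_of_nonneg fun s _ => Real.rpow_nonneg (hr0 s).le _, one_div,
      ENNReal.rpow_inv_le_iff hlam0, ENNReal.ofReal_rpow_of_nonneg
        (Finset.sum_nonneg fun s _ => Real.rpow_nonneg (hr0 s).le _) hlam0.le] at h
    rw [one_div]
    exact (ENNReal.ofReal_le_ofReal_iff (Real.rpow_nonneg
      (Finset.sum_nonneg fun s _ => Real.rpow_nonneg (hr0 s).le _) _)).1 h
  calc e2Kor n d α β γ zstar ≤ ∑ s, γ s / β s * C := by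
        rw [e2Kor_eq_toReal n d α hβ hγ]
        refine ENNReal.toReal_le_of_le_ofReal
          (Finset.sum_nonneg fun s _ => mul_nonneg (hr0 s).le hC0) ?_
        rw [ENNReal.ofReal_sum_of_nonneg fun s _ => mul_nonneg (hr0 s).le hC0]
        exact (dualSum_le_sum_activePart (y := y) fun s j hj => if_pos hj).trans
          (Finset.sum_le_sum fun s _ => hterm s)
    _ = (∑ s, γ s / β s) * C := (Finset.sum_mul ..).symm
    _ ≤ (∑ s, (γ s / β s) ^ (1 / lam)) ^ lam * C := mul_le_mul_of_nonneg_right hsum hC0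
    _ = _ := by simp only [hC]; ring
end

section
/- Let α > 1/2 and 1 ≤ λ < 2α, let β_1, β_2, … and γ_1, γ_2, … be positive reals satisfying the summability condition S := Σ_{j=1}^∞ (γ_j/β_j)^{1/λ} < ∞. Then for every dimension d ≥ 1, every prime n, every initial vector z⁰ ∈ {0,…,n−1}^d, and every output z* ∈ {0,…,n−1}^d of the successive coordinate search algorithm started from z⁰, the normalized squared worst-case error satisfies e²_{n,d}(z*) / ∏_{j=1}^d β_j ≤ 2^λ · S^λ · μ_{α,λ}^λ · exp(λ μ_{α,λ} S) · n^{−λ}, where μ_{α,λ} = 2 ζ(2α/λ); in particular the bound is independent of the dimension d. -/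
open scoped ENNReal

theorem ENNReal.sum_rpow_le {ι : Type*} (s : Finset ι) (f : ι → ℝ≥0∞) {q : ℝ} (hq0 : 0 < q)
    (hq1 : q ≤ 1) : (∑ i ∈ s, f i) ^ q ≤ ∑ i ∈ s, f i ^ q :=
  Finset.le_sum_of_subadditive (fun x : ℝ≥0∞ => x ^ q) (ENNReal.zero_rpow_of_pos hq0).le
    (fun a b => ENNReal.rpow_add_le_add_rpow a b hq0.le hq1) s f

theorem ENNReal.tsum_rpow_le {ι : Type*} (f : ι → ℝ≥0∞) {q : ℝ} (hq0 : 0 < q)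
    (hq1 : q ≤ 1) : (∑' i, f i) ^ q ≤ ∑' i, f i ^ q := by
  rw [← ENNReal.le_rpow_inv_iff hq0, ENNReal.tsum_eq_iSup_sum]
  refine iSup_le fun s => ?_
  rw [ENNReal.le_rpow_inv_iff hq0]
  exact (ENNReal.sum_rpow_le s f hq0 hq1).trans (ENNReal.sum_le_tsum s)

theorem ENNReal.tsum_pi_prod {κ : Type*} {d : ℕ} (F : Fin d → κ → ℝ≥0∞) :
    ∑' h : Fin d → κ, ∏ j, F j (h j) = ∏ j, ∑' k, F j k := by
  induction d with
  | zero => simp [tsum_fintype]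
  | succ d ih =>
    rw [← (Fin.consEquiv fun _ => κ).tsum_eq, ENNReal.tsum_prod', Fin.prod_univ_succ,
      ← ih, ← ENNReal.tsum_mul_right]
    refine tsum_congr fun k => ?_
    rw [← ENNReal.tsum_mul_left]
    exact tsum_congr fun h => by simp [Fin.prod_univ_succ, Fin.consEquiv]

theorem riemannZeta_re_eq_tsum {p : ℝ} (hp : 1 < p) :
    (riemannZeta (p : ℂ)).re = ∑' n : ℕ, ((n : ℝ) + 1) ^ (-p) := by
  rw [zeta_eq_tsum_one_div_nat_add_one_cpow (by simpa using hp), ← Complex.ofReal_re (∑' n : ℕ, _)]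
  congr 1
  push_cast
  refine tsum_congr fun n => ?_
  rw [Complex.ofReal_cpow (by positivity)]
  push_cast
  rw [Complex.cpow_neg, one_div]

theorem tsum_int_abs_rpow_neg {p : ℝ} (hp : 1 < p) :
    ∑' k : ℤ, (if k = 0 then 0 else ENNReal.ofReal (|(k : ℝ)| ^ (-p)))
      = ENNReal.ofReal (2 * (riemannZeta (p : ℂ)).re) := by
  have hs : Summable fun n : ℕ => ((n : ℝ) + 1) ^ (-p) := by
    simpa using (summable_nat_add_iff 1).2 (Real.summable_nat_rpow.2 (neg_lt_neg hp))
  rw [tsum_of_add_one_of_neg_add_one ENNReal.summable ENNReal.summable, two_mul,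
    ENNReal.ofReal_add, riemannZeta_re_eq_tsum hp,
    ENNReal.ofReal_tsum_of_nonneg (fun n => by positivity) hs]
  · have h1 (n : ℕ) : (n : ℤ) + 1 ≠ 0 := by omega
    have h2 (n : ℕ) : -1 + -(n : ℤ) ≠ 0 := by omega
    have h3 (n : ℕ) : |(n : ℝ) + 1| = n + 1 := abs_of_nonneg (by positivity)
    have h4 (n : ℕ) : |-1 + -(n : ℝ)| = n + 1 := by rw [← h3, ← abs_neg]; congr 1; ring
    simp [h1, h2, h3, h4]
  all_goals
    rw [riemannZeta_re_eq_tsum hp]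
    exact tsum_nonneg fun n => by positivity

theorem tsum_int_dvd_abs_rpow_neg {p : ℝ} {n : ℕ} (hn : n ≠ 0) :
    ∑' k : ℤ, (if k = 0 then 0 else
        if (n : ℤ) ∣ k then ENNReal.ofReal (|(k : ℝ)| ^ (-p)) else 0)
      = ENNReal.ofReal ((n : ℝ) ^ (-p)) *
        ∑' k : ℤ, (if k = 0 then 0 else ENNReal.ofReal (|(k : ℝ)| ^ (-p))) := by
  have hinj : Function.Injective fun k : ℤ => (n : ℤ) * k :=
    mul_right_injective₀ (by exact_mod_cast hn)
  rw [← hinj.tsum_eq, ← ENNReal.tsum_mul_left]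
  · refine tsum_congr fun k => ?_
    by_cases hk : k = 0
    · simp [hk]
    · have : (n : ℤ) * k ≠ 0 := by positivity
      simp only [this, hk, if_false, dvd_mul_right, if_true]
      rw [← ENNReal.ofReal_mul (by positivity), Int.cast_mul, abs_mul,
        Real.mul_rpow (abs_nonneg _) (abs_nonneg _)]
      simp
  · intro k hk
    by_cases h0 : k = 0
    · simp [h0] at hk
    by_cases hd : (n : ℤ) ∣ k
    · obtain ⟨m, rfl⟩ := hd
      exact ⟨m, rfl⟩
    · simp [hd] at hk

/-- The normalized one-dimensional Korobov weight with exponent `p`: `1` at `0` and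
`η |k|^{-p}` at `k ≠ 0`. -/
noncomputable def korobovWeight (p η : ℝ) (k : ℤ) : ℝ≥0∞ :=
  if k = 0 then 1 else ENNReal.ofReal (η * |(k : ℝ)| ^ (-p))

theorem korobovWeight_ne_top (p η : ℝ) (k : ℤ) : korobovWeight p η k ≠ ∞ := by
  unfold korobovWeight; split_ifs <;> simp

theorem korobovWeight_rpow {p η q : ℝ} (hη : 0 ≤ η) (hq : 0 ≤ q) (k : ℤ) :
    korobovWeight p η k ^ q = korobovWeight (p * q) (η ^ q) k := by
  unfold korobovWeight
  split_ifs
  · simp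
  · rw [ENNReal.ofReal_rpow_of_nonneg (by positivity) hq, Real.mul_rpow hη (by positivity),
      ← Real.rpow_mul (abs_nonneg _), neg_mul]

theorem tsum_korobovWeight {p η : ℝ} (hp : 1 < p) (hη : 0 ≤ η) :
    ∑' k, korobovWeight p η k = ENNReal.ofReal (1 + η * (2 * (riemannZeta (p : ℂ)).re)) := by
  have hz : 0 ≤ (riemannZeta (p : ℂ)).re := by
    rw [riemannZeta_re_eq_tsum hp]
    exact tsum_nonneg fun n => by positivity
  rw [ENNReal.ofReal_add zero_le_one (by positivity), ENNReal.ofReal_mul hη,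
    ← tsum_int_abs_rpow_neg hp, ENNReal.ofReal_one, ← ENNReal.tsum_mul_left,
    ← tsum_ite_eq (0 : ℤ) (fun _ => (1 : ℝ≥0∞)), ← ENNReal.tsum_add]
  refine tsum_congr fun k => ?_
  unfold korobovWeight
  split_ifs <;> simp [ENNReal.ofReal_mul hη]

/-- Summing over the `n` candidates for one component, a nonzero frequency `k` in that component is
hit once, or possibly `n` times if `n ∣ k`. The one-dimensional sum with these multiplicities. -/
theorem tsum_korobovWeight_mul_le {p η : ℝ} (hp : 1 < p) (hη : 0 ≤ η) {n : ℕ} (hn : n ≠ 0) :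
    ∑' k : ℤ, (if k = 0 then 0 else (if (n : ℤ) ∣ k then (n : ℝ≥0∞) else 1) * korobovWeight p η k)
      ≤ ENNReal.ofReal (2 * (η * (2 * (riemannZeta (p : ℂ)).re))) := by
  have hn1 : (1 : ℝ) ≤ n := by exact_mod_cast Nat.one_le_iff_ne_zero.2 hn
  calc _ ≤ ∑' k : ℤ, (ENNReal.ofReal η *
            (if k = 0 then 0 else ENNReal.ofReal (|(k : ℝ)| ^ (-p))) +
          ENNReal.ofReal η * (n * (if k = 0 then 0 else
            if (n : ℤ) ∣ k then ENNReal.ofReal (|(k : ℝ)| ^ (-p)) else 0))) := by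
        refine ENNReal.tsum_le_tsum fun k => ?_
        unfold korobovWeight
        rw [ENNReal.ofReal_mul hη]
        split_ifs
        · simp
        · exact le_add_left (by rw [mul_left_comm])
        · simp
    _ = ENNReal.ofReal η * (ENNReal.ofReal (2 * (riemannZeta (p : ℂ)).re) +
          ENNReal.ofReal (n * (n : ℝ) ^ (-p)) * ENNReal.ofReal (2 * (riemannZeta (p : ℂ)).re)) := by
        rw [ENNReal.tsum_add, ENNReal.tsum_mul_left, ENNReal.tsum_mul_left, ENNReal.tsum_mul_left,
          tsum_int_dvd_abs_rpow_neg hn, tsum_int_abs_rpow_neg hp, mul_add,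
          ENNReal.ofReal_mul (Nat.cast_nonneg n), ENNReal.ofReal_natCast, mul_assoc]
    _ ≤ ENNReal.ofReal η * (ENNReal.ofReal (2 * (riemannZeta (p : ℂ)).re) +
          1 * ENNReal.ofReal (2 * (riemannZeta (p : ℂ)).re)) := by
        gcongr
        rw [ENNReal.ofReal_le_one]
        nth_rw 1 [← Real.rpow_one (n : ℝ)]
        rw [← Real.rpow_add (by positivity)]
        exact Real.rpow_le_one_of_one_le_of_nonpos hn1 (by linarith)
    _ = _ := by
        rw [one_mul, ← two_mul, ENNReal.ofReal_mul (p := 2) (q := η * _) zero_le_two,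
          ENNReal.ofReal_mul hη, ENNReal.ofReal_ofNat, mul_left_comm]

open Classical in
/-- The sum of `∏ j, W j (h j)` over the frequencies `h` in the dual lattice of `z` that
satisfy `P`. -/
noncomputable def dualLatticeSum {d : ℕ} (n : ℕ) (W : Fin d → ℤ → ℝ≥0∞) (P : (Fin d → ℤ) → Prop)
    (z : Fin d → ℕ) : ℝ≥0∞ :=
  ∑' h : Fin d → ℤ, if P h ∧ (n : ℤ) ∣ ∑ j, h j * (z j : ℤ) then ∏ j, W j (h j) else 0

theorem dualLatticeSum_le {d : ℕ} (n : ℕ) (W : Fin d → ℤ → ℝ≥0∞) (P : (Fin d → ℤ) → Prop)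
    (z : Fin d → ℕ) : dualLatticeSum n W P z ≤ ∏ j, ∑' k, W j k := by
  rw [← ENNReal.tsum_pi_prod]
  refine ENNReal.tsum_le_tsum fun h => ?_
  split_ifs <;> simp

theorem dualLatticeSum_korobovWeight_ne_top {d : ℕ} {p : ℝ} (hp : 1 < p) (n : ℕ) {η : Fin d → ℝ}
    (hη : ∀ j, 0 ≤ η j) (P : (Fin d → ℤ) → Prop) (z : Fin d → ℕ) :
    dualLatticeSum n (fun j => korobovWeight p (η j)) P z ≠ ∞ := by
  refine ne_top_of_le_ne_top ?_ (dualLatticeSum_le n _ P z)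
  exact ENNReal.prod_ne_top fun j _ => by
    rw [tsum_korobovWeight hp (hη j)]; exact ENNReal.ofReal_ne_top

theorem e2Kor_eq {d : ℕ} (n : ℕ) {α : ℝ} {β γ : Fin d → ℝ} (hβ : ∀ j, 0 < β j)
    (hγ : ∀ j, 0 < γ j) (z : Fin d → ℕ) :
    e2Kor n d α β γ z = (∏ j, β j) *
      (dualLatticeSum n (fun j => korobovWeight (2 * α) (γ j / β j)) (· ≠ 0) z).toReal := by
  unfold e2Kor dualLatticeSum
  rw [ENNReal.tsum_toReal_eq, ← tsum_mul_left]
  · refine tsum_congr fun h => ?_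
    by_cases hc : h ≠ 0 ∧ (n : ℤ) ∣ ∑ j, h j * (z j : ℤ)
    · rw [if_pos hc, if_pos hc, ENNReal.toReal_prod, Finset.prod_filter, Finset.prod_filter,
        ← Finset.prod_inv_distrib, ← Finset.prod_mul_distrib, ← Finset.prod_mul_distrib,
        ← Finset.prod_mul_distrib]
      refine Finset.prod_congr rfl fun j _ => ?_
      simp only [rAlpha, korobovWeight]
      by_cases hj : h j = 0
      · simp [hj]
      · have h1 := (hβ j).ne'
        have h2 := hγ j
        have h3 := hβ j
        rw [if_neg hj, if_pos hj, if_neg hj, if_neg hj, ENNReal.toReal_ofReal (by positivity),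
          Real.rpow_neg (abs_nonneg _)]
        field_simp
    · rw [if_neg hc, if_neg hc]; simp
  · intro h
    split_ifs
    · exact ENNReal.prod_ne_top fun j _ => korobovWeight_ne_top _ _ _
    · simp

theorem dualLatticeSum_ne_zero_eq_add {d : ℕ} (n : ℕ) (W : Fin d → ℤ → ℝ≥0∞) (s : Fin d)
    (z : Fin d → ℕ) : dualLatticeSum n W (· ≠ 0) z =
      dualLatticeSum n W (fun h => h s ≠ 0) z +
        dualLatticeSum n W (fun h => h ≠ 0 ∧ h s = 0) z := by
  unfold dualLatticeSum
  rw [← ENNReal.tsum_add]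
  refine tsum_congr fun h => ?_
  by_cases hs : h s = 0
  · simp [hs]
  · have : h ≠ 0 := fun h0 => hs (by simp [h0])
    simp [hs, this]

theorem dualLatticeSum_congr {d : ℕ} (n : ℕ) (W : Fin d → ℤ → ℝ≥0∞) (P : (Fin d → ℤ) → Prop)
    {z z' : Fin d → ℕ} (hz : ∀ h, P h → ∀ j, h j ≠ 0 → z j = z' j) :
    dualLatticeSum n W P z = dualLatticeSum n W P z' := by
  unfold dualLatticeSum
  refine tsum_congr fun h => ?_
  by_cases hP : P h
  swap
  · simp [hP]
  have : ∑ j, h j * (z j : ℤ) = ∑ j, h j * (z' j : ℤ) := by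
    refine Finset.sum_congr rfl fun j _ => ?_
    by_cases hj : h j = 0
    · simp [hj]
    · rw [hz h hP j hj]
  rw [this]

/-- Each nonzero frequency is counted at the position of its last nonzero entry. -/
theorem dualLatticeSum_ne_zero_le_sum {d : ℕ} (n : ℕ) (W : Fin d → ℤ → ℝ≥0∞)
    (z : Fin d → ℕ) (z' : Fin d → Fin d → ℕ) (hz : ∀ s, ∀ j ≤ s, z' s j = z j) :
    dualLatticeSum n W (· ≠ 0) z ≤ ∑ s, dualLatticeSum n W (fun h => h s ≠ 0) (z' s) := by
  unfold dualLatticeSum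
  rw [← Summable.tsum_finsetSum fun _ _ => ENNReal.summable]
  refine ENNReal.tsum_le_tsum fun h => ?_
  by_cases hc : h ≠ 0 ∧ (n : ℤ) ∣ ∑ j, h j * (z j : ℤ)
  swap
  · rw [if_neg hc]; exact zero_le
  obtain ⟨s, hs, hmax⟩ : ∃ s, h s ≠ 0 ∧ ∀ j, s < j → h j = 0 := by
    have hne : (Finset.univ.filter fun j => h j ≠ 0).Nonempty := by
      obtain ⟨j, hj⟩ := Function.ne_iff.1 hc.1
      exact ⟨j, by simpa using hj⟩
    refine ⟨_, (Finset.mem_filter.1 (Finset.max'_mem _ hne)).2, fun j hj => ?_⟩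
    by_contra h0
    exact (Finset.le_max' (Finset.univ.filter fun j => h j ≠ 0) j (by simpa using h0)).not_gt hj
  have hsum : ∑ j, h j * (z' s j : ℤ) = ∑ j, h j * (z j : ℤ) := by
    refine Finset.sum_congr rfl fun j _ => ?_
    rcases le_or_gt j s with hj | hj
    · rw [hz s j hj]
    · simp [hmax j hj]
  refine le_trans ?_ (Finset.single_le_sum (fun _ _ => zero_le) (Finset.mem_univ s))
  rw [if_pos hc, if_pos ⟨hs, hsum ▸ hc.2⟩]

theorem dualLatticeSum_rpow_le {d : ℕ} (n : ℕ) (W : Fin d → ℤ → ℝ≥0∞) (P : (Fin d → ℤ) → Prop)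
    (z : Fin d → ℕ) {q : ℝ} (hq0 : 0 < q) (hq1 : q ≤ 1) :
    dualLatticeSum n W P z ^ q ≤ dualLatticeSum n (fun j k => W j k ^ q) P z := by
  refine (ENNReal.tsum_rpow_le _ hq0 hq1).trans (le_of_eq (tsum_congr fun h => ?_))
  split_ifs
  · rw [ENNReal.prod_rpow_of_nonneg hq0.le]
  · exact ENNReal.zero_rpow_of_pos hq0

theorem card_filter_dvd_add_mul_le {n : ℕ} (hn : n.Prime) (a k : ℤ) :
    ((Finset.range n).filter fun w : ℕ => (n : ℤ) ∣ a + k * w).card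
      ≤ if (n : ℤ) ∣ k then n else 1 := by
  split_ifs with hk
  · exact (Finset.card_filter_le _ _).trans (Finset.card_range n).le
  · refine Finset.card_le_one.2 fun w hw w' hw' => ?_
    simp only [Finset.mem_filter, Finset.mem_range] at hw hw'
    have h1 : (n : ℤ) ∣ k * ((w : ℤ) - w') := by
      have := dvd_sub hw.2 hw'.2
      rwa [add_sub_add_left_eq_sub, ← mul_sub] at this
    have h2 := ((Nat.prime_iff_prime_int.1 hn).dvd_or_dvd h1).resolve_left hk
    have h3 := Int.eq_zero_of_abs_lt_dvd h2 (by rw [abs_lt]; omega)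
    omega

theorem sum_dualLatticeSum_update_le {d n : ℕ} (hn : n.Prime) (W : Fin d → ℤ → ℝ≥0∞) (s : Fin d)
    (z : Fin d → ℕ) :
    ∑ w ∈ Finset.range n, dualLatticeSum n W (fun h => h s ≠ 0) (Function.update z s w) ≤
      (∑' k : ℤ, (if k = 0 then 0 else (if (n : ℤ) ∣ k then (n : ℝ≥0∞) else 1) * W s k)) *
        ∏ j ∈ Finset.univ.erase s, ∑' k, W j k := by
  have hprod (F : Fin d → ℝ≥0∞) (G : Fin d → ℝ≥0∞) (hFG : ∀ j ≠ s, F j = G j) :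
      ∏ j, F j = F s * ∏ j ∈ Finset.univ.erase s, G j := by
    rw [← Finset.mul_prod_erase _ _ (Finset.mem_univ s)]
    congr 1
    exact Finset.prod_congr rfl fun j hj => hFG j (Finset.ne_of_mem_erase hj)
  let F : Fin d → ℤ → ℝ≥0∞ := Function.update W s fun k =>
    if k = 0 then 0 else (if (n : ℤ) ∣ k then (n : ℝ≥0∞) else 1) * W s k
  have hF : ∏ j, ∑' k, F j k = (∑' k : ℤ, (if k = 0 then 0 else
      (if (n : ℤ) ∣ k then (n : ℝ≥0∞) else 1) * W s k)) *
        ∏ j ∈ Finset.univ.erase s, ∑' k, W j k := by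
    rw [hprod _ (fun j => ∑' k, W j k) fun j hj => by simp [F, hj]]
    simp [F]
  rw [← hF, ← ENNReal.tsum_pi_prod]
  unfold dualLatticeSum
  rw [← Summable.tsum_finsetSum fun _ _ => ENNReal.summable]
  refine ENNReal.tsum_le_tsum fun h => ?_
  rw [hprod (fun j => F j (h j)) (fun j => W j (h j)) fun j hj => by simp [F, hj]]
  by_cases hs : h s = 0
  · simp [hs]
  have hdot (w : ℕ) : ∑ j, h j * (Function.update z s w j : ℤ) =
      ∑ j ∈ Finset.univ.erase s, h j * (z j : ℤ) + h s * w := by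
    rw [← Finset.sum_erase_add _ _ (Finset.mem_univ s), Function.update_self]
    congr 1
    exact Finset.sum_congr rfl fun j hj => by
      rw [Function.update_of_ne (Finset.ne_of_mem_erase hj)]
  simp only [hdot, hs, ne_eq, not_false_eq_true, true_and, F, Function.update_self, if_false]
  rw [← Finset.sum_filter, Finset.sum_const, nsmul_eq_mul, mul_assoc,
    Finset.mul_prod_erase _ (fun j => W j (h j)) (Finset.mem_univ s)]
  gcongr
  have := card_filter_dvd_add_mul_le hn (∑ j ∈ Finset.univ.erase s, h j * (z j : ℤ)) (h s)
  split_ifs at this ⊢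
  · exact_mod_cast this
  · exact_mod_cast this

/-- Dimension-independent (tractability) bound for the SCS algorithm: if the weight sequences
satisfy `S = ∑_{j=1}^∞ (γ_j/β_j)^{1/λ} < ∞` for some `1 ≤ λ < 2α`, then for every `d ≥ 1`,
every prime `n`, every initial vector `z⁰` and every SCS output `z*`,
`e²_{n,d}(z*) / ∏_{j=1}^d β_j ≤ 2^λ S^λ μ_{α,λ}^λ exp(λ μ_{α,λ} S) n^{−λ}`. -/
theorem scs_korobov_tractability (α lam : ℝ) (hα : 1 / 2 < α)
    (hlam1 : 1 ≤ lam) (hlam2 : lam < 2 * α)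
    (β γ : ℕ → ℝ) (hβ : ∀ j, 0 < β j) (hγ : ∀ j, 0 < γ j)
    (hS : Summable fun j : ℕ => (γ j / β j) ^ (1 / lam)) :
    ∀ d : ℕ, 1 ≤ d → ∀ n : ℕ, n.Prime →
      ∀ z0 zstar : Fin d → ℕ, (∀ j, z0 j < n) → (∀ j, zstar j < n) →
      (∀ s : Fin d, ∀ w < n,
        e2Kor n d α (fun j => β j.val) (fun j => γ j.val)
            (fun j => if j ≤ s then zstar j else z0 j)
          ≤ e2Kor n d α (fun j => β j.val) (fun j => γ j.val)
            (fun j => if j < s then zstar j else if j = s then w else z0 j)) →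
      e2Kor n d α (fun j => β j.val) (fun j => γ j.val) zstar / ∏ j : Fin d, β j.val
        ≤ 2 ^ lam * (∑' j : ℕ, (γ j / β j) ^ (1 / lam)) ^ lam * muAL α lam ^ lam
            * Real.exp (lam * muAL α lam * ∑' j : ℕ, (γ j / β j) ^ (1 / lam))
            * (n : ℝ) ^ (-lam) := by
  intro d _ n hn z0 zstar _ _ hscs
  set S := ∑' j : ℕ, (γ j / β j) ^ (1 / lam) with hSdef
  set μ := muAL α lam with hμdef
  have hlam0 : 0 < lam := by linarith
  have hp : 1 < 2 * α / lam := (one_lt_div hlam0).2 hlam2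
  have hμ0 : 0 ≤ μ := by
    rw [hμdef, muAL, riemannZeta_re_eq_tsum hp]
    exact mul_nonneg zero_le_two (tsum_nonneg fun n => by positivity)
  have hn0 : (0 : ℝ) < n := by exact_mod_cast hn.pos
  have hη (j : ℕ) : 0 < γ j / β j := div_pos (hγ j) (hβ j)
  have hS0 : 0 ≤ S := tsum_nonneg fun j => (Real.rpow_pos_of_pos (hη j) _).le
  have hsum_le : ∑ j : Fin d, (γ j.val / β j.val) ^ (1 / lam) ≤ S := by
    rw [Fin.sum_univ_eq_sum_range fun j => (γ j / β j) ^ (1 / lam)]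
    exact hS.sum_le_tsum _ fun j _ => (Real.rpow_pos_of_pos (hη j) _).le
  have hβprod : 0 < ∏ j : Fin d, β j.val := Finset.prod_pos fun j _ => hβ _
  let W : Fin d → ℤ → ℝ≥0∞ := fun j => korobovWeight (2 * α) (γ j.val / β j.val)
  have hW (z : Fin d → ℕ) : e2Kor n d α (fun j => β j.val) (fun j => γ j.val) z =
      (∏ j : Fin d, β j.val) * (dualLatticeSum n W (· ≠ 0) z).toReal :=
    e2Kor_eq n (fun j => hβ _) (fun j => hγ _) z
  have htop (P : (Fin d → ℤ) → Prop) (z : Fin d → ℕ) : dualLatticeSum n W P z ≠ ∞ :=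
    dualLatticeSum_korobovWeight_ne_top (by linarith) n (fun j => (hη _).le) P z
  let z' : Fin d → Fin d → ℕ := fun s j => if j ≤ s then zstar j else z0 j
  have hmin (s : Fin d) (w : ℕ) (hw : w < n) :
      dualLatticeSum n W (fun h => h s ≠ 0) (z' s) ≤
        dualLatticeSum n W (fun h => h s ≠ 0) (Function.update (z' s) s w) := by
    have hupd : (fun j => if j < s then zstar j else if j = s then w else z0 j) =
        Function.update (z' s) s w := by
      funext j
      rcases lt_trichotomy j s with hj | rfl | hj
      · simp [z', hj, hj.le, hj.ne]
      · simp
      · simp [z', hj.not_gt, hj.not_ge, hj.ne']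
    have h1 := hscs s w hw
    rw [hupd, hW, hW, mul_le_mul_iff_right₀ hβprod,
      ENNReal.toReal_le_toReal (htop _ _) (htop _ _), dualLatticeSum_ne_zero_eq_add n W s,
      dualLatticeSum_ne_zero_eq_add n W s,
      dualLatticeSum_congr n W (fun h => h ≠ 0 ∧ h s = 0)
        (z := Function.update (z' s) s w) (z' := z' s)
        fun h hh j hj => Function.update_of_ne (fun e => hj (by rw [e, hh.2])) _ _] at h1
    exact (ENNReal.add_le_add_iff_right (htop _ _)).1 h1
  have hstep (s : Fin d) : dualLatticeSum n W (fun h => h s ≠ 0) (z' s) ^ (1 / lam) ≤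
      ENNReal.ofReal (2 * ((γ s.val / β s.val) ^ (1 / lam) * μ) * Real.exp (μ * S) / n) := by
    rw [ENNReal.ofReal_div_of_pos hn0, ENNReal.ofReal_natCast,
      ENNReal.le_div_iff_mul_le (by simp [hn.ne_zero]) (by simp), mul_comm]
    calc (n : ℝ≥0∞) * dualLatticeSum n W (fun h => h s ≠ 0) (z' s) ^ (1 / lam)
        = ∑ w ∈ Finset.range n, dualLatticeSum n W (fun h => h s ≠ 0) (z' s) ^ (1 / lam) := by
          simp
      _ ≤ ∑ w ∈ Finset.range n, dualLatticeSum n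
            (fun j => korobovWeight (2 * α / lam) ((γ j.val / β j.val) ^ (1 / lam)))
            (fun h => h s ≠ 0) (Function.update (z' s) s w) := by
          refine Finset.sum_le_sum fun w hw => ?_
          refine (ENNReal.rpow_le_rpow (hmin s w (Finset.mem_range.1 hw)) (by positivity)).trans ?_
          refine (dualLatticeSum_rpow_le n W _ _ (by positivity)
            ((div_le_one hlam0).2 hlam1)).trans (le_of_eq ?_)
          congr 1
          funext j k
          rw [korobovWeight_rpow (hη _).le (by positivity), mul_one_div]
      _ ≤ ENNReal.ofReal (2 * ((γ s.val / β s.val) ^ (1 / lam) * μ)) *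
            ∏ j ∈ Finset.univ.erase s,
              ENNReal.ofReal (1 + (γ j.val / β j.val) ^ (1 / lam) * μ) := by
          refine (sum_dualLatticeSum_update_le hn _ s (z' s)).trans ?_
          refine mul_le_mul' (tsum_korobovWeight_mul_le hp (by have := hη s; positivity)
            hn.ne_zero) (Finset.prod_le_prod' fun j _ => ?_)
          exact (tsum_korobovWeight hp (by have := hη j; positivity)).le
      _ ≤ ENNReal.ofReal (2 * ((γ s.val / β s.val) ^ (1 / lam) * μ) * Real.exp (μ * S)) := by
          have hs := hη s
          rw [ENNReal.ofReal_mul (q := Real.exp _) (by positivity)]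
          gcongr
          rw [← ENNReal.ofReal_prod_of_nonneg fun j _ => by have := hη j; positivity]
          refine ENNReal.ofReal_le_ofReal ?_
          calc ∏ j ∈ Finset.univ.erase s, (1 + (γ j.val / β j.val) ^ (1 / lam) * μ)
              ≤ ∏ j ∈ Finset.univ.erase s, Real.exp ((γ j.val / β j.val) ^ (1 / lam) * μ) :=
                Finset.prod_le_prod (fun j _ => by have := hη j; positivity) fun j _ => by
                  rw [add_comm]; exact Real.add_one_le_exp _
            _ = Real.exp ((∑ j ∈ Finset.univ.erase s, (γ j.val / β j.val) ^ (1 / lam)) * μ) := by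
                rw [← Real.exp_sum, Finset.sum_mul]
            _ ≤ Real.exp (μ * S) := by
                rw [mul_comm]
                gcongr
                exact (Finset.sum_le_sum_of_subset_of_nonneg (Finset.erase_subset _ _)
                  fun j _ _ => by have := hη j; positivity).trans hsum_le
  have hroot : dualLatticeSum n W (· ≠ 0) zstar ^ (1 / lam) ≤
      ENNReal.ofReal (2 * S * μ * Real.exp (μ * S) / n) := by
    calc dualLatticeSum n W (· ≠ 0) zstar ^ (1 / lam)
        ≤ (∑ s, dualLatticeSum n W (fun h => h s ≠ 0) (z' s)) ^ (1 / lam) :=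
          ENNReal.rpow_le_rpow (dualLatticeSum_ne_zero_le_sum n W zstar z'
            fun s j hj => if_pos hj) (by positivity)
      _ ≤ ∑ s, dualLatticeSum n W (fun h => h s ≠ 0) (z' s) ^ (1 / lam) :=
          ENNReal.sum_rpow_le _ _ (by positivity) ((div_le_one hlam0).2 hlam1)
      _ ≤ ∑ s : Fin d, ENNReal.ofReal
            (2 * ((γ s.val / β s.val) ^ (1 / lam) * μ) * Real.exp (μ * S) / n) :=
          Finset.sum_le_sum fun s _ => hstep s
      _ = ENNReal.ofReal (2 * ((∑ s : Fin d, (γ s.val / β s.val) ^ (1 / lam)) * μ) *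
            Real.exp (μ * S) / n) := by
          rw [← ENNReal.ofReal_sum_of_nonneg fun j _ => by have := hη j; positivity,
            ← Finset.sum_div, ← Finset.sum_mul, ← Finset.mul_sum, ← Finset.sum_mul]
      _ ≤ ENNReal.ofReal (2 * S * μ * Real.exp (μ * S) / n) := by
          rw [mul_assoc 2 S]
          gcongr
  rw [hW, mul_div_cancel_left₀ _ hβprod.ne']
  refine ENNReal.toReal_le_of_le_ofReal (by positivity) ?_
  rw [one_div, ENNReal.rpow_inv_le_iff hlam0,
    ENNReal.ofReal_rpow_of_nonneg (by positivity) hlam0.le] at hroot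
  refine hroot.trans_eq (congrArg ENNReal.ofReal ?_)
  rw [Real.div_rpow (by positivity) hn0.le, Real.mul_rpow (by positivity) (by positivity),
    Real.mul_rpow (by positivity) hμ0, Real.mul_rpow zero_le_two hS0, ← Real.exp_mul,
    Real.rpow_neg hn0.le, ← div_eq_mul_inv]
  congr 3
  ring
end

section
/- Let n ≥ 1 be a natural number, d ≥ 1, α > 1/2, λ ≥ 1, and let γ_1,…,γ_d be positive reals. For any z ∈ ℤ^d and any vectors w^{(1)},…,w^{(d)} ∈ ℤ^d, the squared worst-case error with β_j = 1 satisfies ( e²_{n,d}(z) )^{1/λ} ≤ Σ_{s=1}^d θ_s( z_1,…,z_s, w^{(s)}_{s+1},…,w^{(s)}_d )^{1/λ}. -/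
/-- The squared worst-case error (with `β_j = 1`) of the `n`-point rank-1 lattice rule with
generating vector `z ∈ ℤ^d` in the weighted Korobov space:
`e²_{n,d}(z) = ∑_{0 ≠ h ∈ ℤ^d, h·z ≡ 0 (mod n)} r_α(h)⁻¹ ∏_{j : h_j ≠ 0} γ_j`. -/
noncomputable def e2Kor1 (n d : ℕ) (α : ℝ) (γ : Fin d → ℝ) (z : Fin d → ℤ) : ℝ :=
  ∑' h : Fin d → ℤ,
    if h ≠ 0 ∧ (n : ℤ) ∣ ∑ j, h j * z j then
      (∏ j, rAlpha α (h j))⁻¹ * ∏ j ∈ Finset.univ.filter (fun j => h j ≠ 0), γ j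
    else 0

/-- `θ_s(z) = ∑_{u ⊆ {1,…,d}, s ∈ u} (∏_{j∈u} γ_j)
  ∑_{h ∈ ℤ^d, h_j ≠ 0 ⟺ j ∈ u, ∑_{j∈u} h_j z_j ≡ 0 (mod n)} ∏_{j∈u} r_α(h_j)⁻¹`. -/
noncomputable def theta (n d : ℕ) (α : ℝ) (γ : Fin d → ℝ) (s : Fin d) (z : Fin d → ℤ) : ℝ :=
  ∑ u ∈ Finset.univ.powerset.filter (fun u => s ∈ u),
    (∏ j ∈ u, γ j) *
      ∑' h : Fin d → ℤ,
        if (∀ j, (h j ≠ 0 ↔ j ∈ u)) ∧ (n : ℤ) ∣ ∑ j ∈ u, h j * z j then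
          ∏ j ∈ u, (rAlpha α (h j))⁻¹
        else 0

theorem Real.rpow_sum_le_sum_rpow_of_le_one {ι : Type*} (t : Finset ι) (f : ι → ℝ) {p : ℝ}
    (hf : ∀ i ∈ t, 0 ≤ f i) (hp : 0 < p) (hp1 : p ≤ 1) :
    (∑ i ∈ t, f i) ^ p ≤ ∑ i ∈ t, f i ^ p := by
  classical
  induction t using Finset.induction_on with
  | empty => simp [Real.zero_rpow hp.ne']
  | insert a t ha ih =>
    have ht : ∀ i ∈ t, 0 ≤ f i := fun i hi => hf i (Finset.mem_insert_of_mem hi)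
    rw [Finset.sum_insert ha, Finset.sum_insert ha]
    refine (Real.rpow_add_le_add_rpow (hf a (Finset.mem_insert_self a t))
      (Finset.sum_nonneg ht) hp.le hp1).trans ?_
    gcongr
    exact ih ht

theorem summable_prod_fin_of_nonneg {β : Type*} {g : β → ℝ} (hg : Summable g) (hg0 : 0 ≤ g)
    (d : ℕ) : Summable fun h : Fin d → β => ∏ j, g (h j) := by
  induction d with
  | zero => exact Summable.of_finite
  | succ d ih =>
    rw [← (Fin.consEquiv fun _ : Fin (d + 1) => β).summable_iff]
    have := hg.mul_of_nonneg ih hg0 fun h => Finset.prod_nonneg fun j _ => hg0 (h j)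
    refine this.congr fun x => ?_
    simp [Fin.consEquiv, Fin.prod_univ_succ]

theorem rAlpha_nonneg (α : ℝ) (h : ℤ) : 0 ≤ rAlpha α h := by
  unfold rAlpha
  split_ifs <;> positivity

theorem prod_inv_rAlpha_of_support {d : ℕ} {h : Fin d → ℤ} {u : Finset (Fin d)} (α : ℝ)
    (hu : ∀ j, h j ≠ 0 ↔ j ∈ u) :
    ∏ j ∈ u, (rAlpha α (h j))⁻¹ = ∏ j, (rAlpha α (h j))⁻¹ := by
  refine Finset.prod_subset (Finset.subset_univ u) fun j _ hj => ?_
  have h0 : h j = 0 := by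
    by_contra hne
    exact hj ((hu j).1 hne)
  simp [rAlpha, h0]

/-- The summand of `theta` belonging to the support `u` and the frequency `h`. -/
noncomputable def thetaTerm (n d : ℕ) (α : ℝ) (γ : Fin d → ℝ) (z : Fin d → ℤ)
    (u : Finset (Fin d)) (h : Fin d → ℤ) : ℝ :=
  (∏ j ∈ u, γ j) *
    if (∀ j, (h j ≠ 0 ↔ j ∈ u)) ∧ (n : ℤ) ∣ ∑ j ∈ u, h j * z j then
      ∏ j ∈ u, (rAlpha α (h j))⁻¹
    else 0

section

variable {n d : ℕ} {α : ℝ} {γ : Fin d → ℝ}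

theorem thetaTerm_nonneg (hγ : ∀ j, 0 < γ j) (z : Fin d → ℤ) (u : Finset (Fin d))
    (h : Fin d → ℤ) : 0 ≤ thetaTerm n d α γ z u h := by
  unfold thetaTerm
  refine mul_nonneg (Finset.prod_nonneg fun j _ => (hγ j).le) ?_
  split_ifs
  · exact Finset.prod_nonneg fun j _ => inv_nonneg.2 (rAlpha_nonneg α _)
  · exact le_rfl

theorem summable_thetaTerm (hα : 1 / 2 < α) (z : Fin d → ℤ) (u : Finset (Fin d)) :
    Summable (thetaTerm n d α γ z u) := by
  have hnn : ∀ h : ℤ, 0 ≤ (rAlpha α h)⁻¹ := fun h => inv_nonneg.2 (rAlpha_nonneg α h)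
  refine Summable.mul_left _ (Summable.of_nonneg_of_le (fun h => ?_) (fun h => ?_)
    (summable_prod_fin_of_nonneg (summable_inv_rAlpha hα) hnn d))
  · split_ifs
    · exact Finset.prod_nonneg fun j _ => hnn _
    · exact le_rfl
  · split_ifs with hu
    · exact (prod_inv_rAlpha_of_support α hu.1).le
    · exact Finset.prod_nonneg fun j _ => hnn _

theorem hasSum_theta (hα : 1 / 2 < α) (s : Fin d) (z : Fin d → ℤ) :
    HasSum (fun h => ∑ u ∈ Finset.univ.powerset.filter (fun u => s ∈ u), thetaTerm n d α γ z u h)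
      (theta n d α γ s z) := by
  have hθ : theta n d α γ s z =
      ∑ u ∈ Finset.univ.powerset.filter (fun u => s ∈ u), ∑' h, thetaTerm n d α γ z u h :=
    Finset.sum_congr rfl fun u _ => tsum_mul_left.symm
  rw [hθ]
  exact hasSum_sum fun u _ => (summable_thetaTerm hα z u).hasSum

theorem theta_nonneg (hα : 1 / 2 < α) (hγ : ∀ j, 0 < γ j) (s : Fin d) (z : Fin d → ℤ) :
    0 ≤ theta n d α γ s z :=
  (hasSum_theta hα s z).nonneg fun h =>
    Finset.sum_nonneg fun u _ => thetaTerm_nonneg hγ z u h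

/-- Each nonzero frequency is counted in `theta` at its largest nonzero coordinate, where the
later coordinates of the generating vector play no role. -/
theorem e2Kor1_summand_le (hγ : ∀ j, 0 < γ j) (z : Fin d → ℤ) (w : Fin d → Fin d → ℤ)
    (h : Fin d → ℤ) :
    (if h ≠ 0 ∧ (n : ℤ) ∣ ∑ j, h j * z j then
      (∏ j, rAlpha α (h j))⁻¹ * ∏ j ∈ Finset.univ.filter (fun j => h j ≠ 0), γ j
    else 0) ≤
      ∑ s : Fin d, ∑ u ∈ Finset.univ.powerset.filter (fun u => s ∈ u),
        thetaTerm n d α γ (fun j => if j ≤ s then z j else w s j) u h := by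
  have hnn (s : Fin d) (u : Finset (Fin d)) :
      0 ≤ thetaTerm n d α γ (fun j => if j ≤ s then z j else w s j) u h :=
    thetaTerm_nonneg hγ _ u h
  split_ifs with hh
  · set u : Finset (Fin d) := Finset.univ.filter (fun j => h j ≠ 0) with hu
    have hmem : ∀ j, h j ≠ 0 ↔ j ∈ u := by simp [hu]
    have hne : u.Nonempty := by
      obtain ⟨j, hj⟩ := Function.ne_iff.1 hh.1
      exact ⟨j, (hmem j).1 hj⟩
    set s := u.max' hne
    have hsum : ∑ j ∈ u, h j * (if j ≤ s then z j else w s j) = ∑ j, h j * z j := by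
      rw [← Finset.sum_subset (Finset.subset_univ u)]
      · exact Finset.sum_congr rfl fun j hj => by rw [if_pos (u.le_max' j hj)]
      · intro j _ hj
        rw [not_ne_iff.1 (mt (hmem j).1 hj), zero_mul]
    have hterm : (∏ j, rAlpha α (h j))⁻¹ * ∏ j ∈ u, γ j =
        thetaTerm n d α γ (fun j => if j ≤ s then z j else w s j) u h := by
      rw [thetaTerm, if_pos ⟨hmem, hsum ▸ hh.2⟩, prod_inv_rAlpha_of_support α hmem,
        Finset.prod_inv_distrib, mul_comm]
    rw [hterm]
    refine le_trans ?_ (Finset.single_le_sum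
      (fun s _ => Finset.sum_nonneg fun u _ => hnn s u) (Finset.mem_univ s))
    exact Finset.single_le_sum (fun u _ => hnn s u)
      (Finset.mem_filter.2 ⟨by simp, u.max'_mem hne⟩)
  · exact Finset.sum_nonneg fun s _ => Finset.sum_nonneg fun u _ => hnn s u

theorem e2Kor1_summand_nonneg (hγ : ∀ j, 0 < γ j) (z h : Fin d → ℤ) :
    0 ≤ if h ≠ 0 ∧ (n : ℤ) ∣ ∑ j, h j * z j then
      (∏ j, rAlpha α (h j))⁻¹ * ∏ j ∈ Finset.univ.filter (fun j => h j ≠ 0), γ j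
    else 0 := by
  split_ifs
  · exact mul_nonneg (inv_nonneg.2 (Finset.prod_nonneg fun j _ => rAlpha_nonneg α _))
      (Finset.prod_nonneg fun j _ => (hγ j).le)
  · exact le_rfl

theorem e2Kor1_le_sum_theta (hα : 1 / 2 < α) (hγ : ∀ j, 0 < γ j) (z : Fin d → ℤ)
    (w : Fin d → Fin d → ℤ) :
    e2Kor1 n d α γ z ≤ ∑ s, theta n d α γ s (fun j => if j ≤ s then z j else w s j) := by
  have hsum := hasSum_sum (s := Finset.univ) fun s _ =>
    hasSum_theta (n := n) (γ := γ) hα s (fun j => if j ≤ s then z j else w s j)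
  have hle := e2Kor1_summand_le (n := n) (α := α) hγ z w
  have hs := Summable.of_nonneg_of_le (e2Kor1_summand_nonneg hγ z) hle hsum.summable
  exact hasSum_le hle hs.hasSum hsum

end

/-- Jensen-type decomposition bound: for any `z ∈ ℤ^d` and arbitrary vectors
`w⁽¹⁾,…,w⁽ᵈ⁾ ∈ ℤ^d`, `(e²_{n,d}(z))^{1/λ} ≤ ∑_{s=1}^d θ_s(z_1,…,z_s, w⁽ˢ⁾_{s+1},…,w⁽ˢ⁾_d)^{1/λ}`. -/
theorem e2_pow_le_sum_theta_pow (n d : ℕ) (hn : 1 ≤ n) (hd : 1 ≤ d)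
    (α lam : ℝ) (hα : 1 / 2 < α) (hlam : 1 ≤ lam)
    (γ : Fin d → ℝ) (hγ : ∀ j, 0 < γ j)
    (z : Fin d → ℤ) (w : Fin d → Fin d → ℤ) :
    (e2Kor1 n d α γ z) ^ (1 / lam)
      ≤ ∑ s : Fin d,
          (theta n d α γ s (fun j => if j ≤ s then z j else w s j)) ^ (1 / lam) := by
  have hlam0 : 0 < lam := one_pos.trans_le hlam
  refine (Real.rpow_le_rpow (tsum_nonneg (e2Kor1_summand_nonneg hγ z))
    (e2Kor1_le_sum_theta hα hγ z w) (by positivity)).trans ?_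
  exact Real.rpow_sum_le_sum_rpow_of_le_one _ _ (fun s _ => theta_nonneg hα hγ s _)
    (by positivity) ((div_le_one hlam0).2 hlam)
end

section
/- Let n be a prime number, d ≥ 1, let β_1,…,β_d and γ_1,…,γ_d be positive reals, let a_1,…,a_d ∈ [0,1] be anchors and set c_j = a_j² − a_j + 1/3, β̂_j = β_j + γ_j c_j and γ̂_j = γ_j/(2π²). Let z⁰ ∈ {0,…,n−1}^d be an arbitrary initial vector and let z* ∈ {0,…,n−1}^d be an output of the successive coordinate search algorithm started from z⁰ (with respect to the shift-averaged Sobolev squared worst-case error ê²_{n,d}). Then for every λ with 1 ≤ λ < 2, ê²_{n,d}(z*) ≤ Ĉ_{d,λ} · n^{−λ}, where Ĉ_{d,λ} = 2^λ · ( Σ_{j=1}^d (γ̂_j/β̂_j)^{1/λ} )^λ · ∏_{j=1}^d ( β̂_j^{1/λ} + γ̂_j^{1/λ} μ_{1,λ} )^λ · μ_{1,λ}^λ · max_{s=1,…,d} ( 1 + (γ̂_s/β̂_s)^{1/λ} μ_{1,λ} )^{−λ} and μ_{1,λ} = 2 ζ(2/λ) with ζ the Riemann zeta function. -/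
/-- `B₂(x) = x² − x + 1/6`, the Bernoulli polynomial of degree two. -/
noncomputable def bernoulli2 (x : ℝ) : ℝ := x ^ 2 - x + 1 / 6

/-- The shift-averaged squared worst-case error of the rank-1 lattice rule with generating
vector `z ∈ {0,…,n−1}^d` in the weighted anchored Sobolev space with weights `β`, `γ` and
anchors `a`:
`ê²_{n,d}(z) = −∏_j (β_j + γ_j c_j) + (1/n) ∑_{k<n} ∏_j (β_j + γ_j [B₂({k z_j/n}) + c_j])`
with `c_j = a_j² − a_j + 1/3`. -/
noncomputable def e2Sob (n d : ℕ) (β γ a : Fin d → ℝ) (z : Fin d → ℕ) : ℝ :=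
  - ∏ j, (β j + γ j * (a j ^ 2 - a j + 1 / 3))
  + (1 / (n : ℝ)) * ∑ k ∈ Finset.range n, ∏ j,
      (β j + γ j * (bernoulli2 (Int.fract ((k : ℝ) * (z j : ℝ) / (n : ℝ)))
        + (a j ^ 2 - a j + 1 / 3)))

/-- `μ_{1,λ} = 2 ζ(2/λ)` (real part of the Riemann zeta function at the real point `2/λ`). -/
noncomputable def muL (lam : ℝ) : ℝ := 2 * (riemannZeta ((2 / lam : ℝ) : ℂ)).re

/-- Subadditivity of `x ↦ x ^ p` for `0 < p ≤ 1`. -/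
theorem rpow_sum_le_sum_rpow {ι : Type*} (s : Finset ι) {f : ι → ℝ} (hf : ∀ i, 0 ≤ f i)
    {p : ℝ} (hp : 0 < p) (hp1 : p ≤ 1) : (∑ i ∈ s, f i) ^ p ≤ ∑ i ∈ s, f i ^ p := by
  classical
  induction s using Finset.induction_on with
  | empty => simp [Real.zero_rpow hp.ne']
  | insert i s hi ih =>
    rw [Finset.sum_insert hi, Finset.sum_insert hi]
    exact (Real.rpow_add_le_add_rpow (hf i) (Finset.sum_nonneg fun j _ => hf j) hp.le hp1).trans
      (by gcongr)

theorem rpow_tsum_le_of_hasSum_rpow {ι : Type*} {f : ι → ℝ} (hf : ∀ i, 0 ≤ f i)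
    {p S : ℝ} (hp : 0 < p) (hp1 : p ≤ 1) (hS : HasSum (fun i => f i ^ p) S) :
    (∑' i, f i) ^ p ≤ S := by
  have hS0 : 0 ≤ S := hS.nonneg fun i => Real.rpow_nonneg (hf i) _
  have key : ∑' i, f i ≤ S ^ p⁻¹ := by
    refine Real.tsum_le_of_sum_le hf fun s => ?_
    rw [Real.le_rpow_inv_iff_of_pos (Finset.sum_nonneg fun j _ => hf j) hS0 hp]
    exact (rpow_sum_le_sum_rpow s hf hp hp1).trans
      (sum_le_hasSum s (fun i _ => Real.rpow_nonneg (hf i) _) hS)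
  rwa [Real.le_rpow_inv_iff_of_pos (tsum_nonneg hf) hS0 hp] at key

/-- `F` has nonnegative Fourier coefficients on `ℤ/n` whose `p`-th powers sum to at most `B`. -/
def HasFourierBound (n : ℕ) [NeZero n] (p B : ℝ) (F : ZMod n → ℝ) : Prop :=
  ∃ c : ZMod n → ℝ, (∀ m, 0 ≤ c m) ∧
    (∀ k, ((F k : ℝ) : ℂ) = ∑ m, (c m : ℂ) * ZMod.stdAddChar (m * k)) ∧ ∑ m, c m ^ p ≤ B

namespace HasFourierBound

variable {n : ℕ} [NeZero n] {p : ℝ}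

theorem of_fintype {ι : Type*} [Fintype ι] (hp : 0 < p) (hp1 : p ≤ 1) {F : ZMod n → ℝ} {B : ℝ}
    (a : ι → ℝ) (ha : ∀ i, 0 ≤ a i) (t : ι → ZMod n)
    (hF : ∀ k, ((F k : ℝ) : ℂ) = ∑ i, (a i : ℂ) * ZMod.stdAddChar (t i * k))
    (hB : ∑ i, a i ^ p ≤ B) : HasFourierBound n p B F := by
  classical
  refine ⟨fun m => ∑ i with t i = m, a i, fun m => Finset.sum_nonneg fun i _ => ha i,
    fun k => ?_, ?_⟩
  · rw [hF, ← Finset.sum_fiberwise Finset.univ t]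
    refine Finset.sum_congr rfl fun m _ => ?_
    rw [Complex.ofReal_sum, Finset.sum_mul]
    refine Finset.sum_congr rfl fun i hi => ?_
    rw [(Finset.mem_filter.mp hi).2]
  · refine le_trans (Finset.sum_le_sum fun m _ => rpow_sum_le_sum_rpow _ ha hp hp1) ?_
    rwa [Finset.sum_fiberwise Finset.univ t]

theorem const (hp : 0 < p) (hp1 : p ≤ 1) {b : ℝ} (hb : 0 ≤ b) :
    HasFourierBound n p (b ^ p) fun _ => b :=
  of_fintype hp hp1 (fun _ : Unit => b) (fun _ => hb) (fun _ => 0) (by simp) (by simp)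

theorem add (hp : 0 < p) (hp1 : p ≤ 1) {F G : ZMod n → ℝ} {B C : ℝ}
    (hF : HasFourierBound n p B F) (hG : HasFourierBound n p C G) :
    HasFourierBound n p (B + C) fun k => F k + G k := by
  obtain ⟨c, hc, hcF, hcB⟩ := hF
  obtain ⟨e, he, heG, heC⟩ := hG
  refine of_fintype hp hp1 (Sum.elim c e) (by rintro (i | i) <;> simp [hc, he])
    (Sum.elim id id) (fun k => ?_) ?_
  · simp [hcF, heG]
  · simpa using add_le_add hcB heC

theorem mul (hp : 0 < p) (hp1 : p ≤ 1) {F G : ZMod n → ℝ} {B C : ℝ}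
    (hF : HasFourierBound n p B F) (hG : HasFourierBound n p C G) :
    HasFourierBound n p (B * C) fun k => F k * G k := by
  obtain ⟨c, hc, hcF, hcB⟩ := hF
  obtain ⟨e, he, heG, heC⟩ := hG
  refine of_fintype hp hp1 (fun i : ZMod n × ZMod n => c i.1 * e i.2)
    (fun i => mul_nonneg (hc _) (he _)) (fun i => i.1 + i.2) (fun k => ?_) ?_
  · rw [Complex.ofReal_mul, hcF, heG, Finset.sum_mul_sum, Fintype.sum_prod_type]
    refine Finset.sum_congr rfl fun i _ => Finset.sum_congr rfl fun j _ => ?_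
    rw [add_mul, AddChar.map_add_eq_mul]
    push_cast
    ring
  · simp only [Real.mul_rpow (hc _) (he _)]
    rw [Fintype.sum_prod_type]
    simp only [← Finset.mul_sum, ← Finset.sum_mul]
    exact mul_le_mul hcB heC (Finset.sum_nonneg fun i _ => Real.rpow_nonneg (he i) _)
      ((Finset.sum_nonneg fun i _ => Real.rpow_nonneg (hc i) _).trans hcB)

theorem comp_mul (hp : 0 < p) (hp1 : p ≤ 1) {F : ZMod n → ℝ} {B : ℝ}
    (hF : HasFourierBound n p B F) (z : ZMod n) :
    HasFourierBound n p B fun k => F (k * z) := by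
  obtain ⟨c, hc, hcF, hcB⟩ := hF
  refine of_fintype hp hp1 c hc (fun i => i * z) (fun k => ?_) hcB
  rw [hcF]
  simp only [mul_comm k, mul_assoc]

theorem prod (hp : 0 < p) (hp1 : p ≤ 1) {ι : Type*} (s : Finset ι) {F : ι → ZMod n → ℝ}
    {B : ι → ℝ} (hF : ∀ i, HasFourierBound n p (B i) (F i)) :
    HasFourierBound n p (∏ i ∈ s, B i) fun k => ∏ i ∈ s, F i k := by
  classical
  induction s using Finset.induction_on with
  | empty => simpa using const (n := n) hp hp1 zero_le_one
  | insert i s hi ih =>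
    simp only [Finset.prod_insert hi]
    exact mul hp hp1 (hF i) ih

/-- Subtracting the constant term of a product of shifted functions keeps the Fourier
coefficients nonnegative. -/
theorem exists_prod_add_sub_prod (hp : 0 < p) (hp1 : p ≤ 1) {ι : Type*} (s : Finset ι)
    {b : ι → ℝ} (hb : ∀ i, 0 ≤ b i) {F : ι → ZMod n → ℝ} {B : ι → ℝ}
    (hF : ∀ i, HasFourierBound n p (B i) (F i)) :
    ∃ C, HasFourierBound n p C fun k => ∏ i ∈ s, (b i + F i k) - ∏ i ∈ s, b i := by
  classical
  induction s using Finset.induction_on with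
  | empty => exact ⟨_, by simpa using const (n := n) hp hp1 le_rfl⟩
  | insert i s hi ih =>
    obtain ⟨C, hC⟩ := ih
    have h := add hp hp1
      (mul hp hp1 (hF i) (prod hp hp1 s fun j => add hp hp1 (const hp hp1 (hb j)) (hF j)))
      (mul hp hp1 (const hp hp1 (hb i)) hC)
    have heq : (fun k => ∏ j ∈ insert i s, (b j + F j k) - ∏ j ∈ insert i s, b j) = fun k =>
        F i k * ∏ j ∈ s, (b j + F j k) + b i * (∏ j ∈ s, (b j + F j k) - ∏ j ∈ s, b j) := by
      funext k
      rw [Finset.prod_insert hi, Finset.prod_insert hi]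
      ring
    exact ⟨_, heq ▸ h⟩

theorem sum_stdAddChar (m : ZMod n) :
    ∑ k : ZMod n, ZMod.stdAddChar (m * k) = if m = 0 then (n : ℂ) else 0 := by
  simpa [mul_comm] using AddChar.sum_mulShift m (ZMod.isPrimitive_stdAddChar n)

theorem sum_nonneg {F : ZMod n → ℝ} {B : ℝ} (hF : HasFourierBound n p B F) :
    0 ≤ ∑ k, F k := by
  obtain ⟨c, hc, hcF, -⟩ := hF
  have h : ((∑ k, F k : ℝ) : ℂ) = ((n * c 0 : ℝ) : ℂ) := by
    push_cast
    simp only [hcF]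
    rw [Finset.sum_comm]
    simp only [← Finset.mul_sum, sum_stdAddChar]
    simp [mul_comm]
  rw [Complex.ofReal_inj.mp h]
  exact mul_nonneg (Nat.cast_nonneg n) (hc 0)

/-- Averaging over the dilation parameter `w`: some `w` makes the mean of `F k * φ (k w)` small. -/
theorem exists_mean_mul_comp_mul_le (hn : n.Prime) (hp : 0 < p) (hp1 : p ≤ 1)
    {F φ : ZMod n → ℝ} {B M : ℝ} (hF : HasFourierBound n p B F)
    {g : ZMod n → ℝ} (hg : ∀ m, 0 ≤ g m)
    (hgφ : ∀ k, ((φ k : ℝ) : ℂ) = ∑ m, (g m : ℂ) * ZMod.stdAddChar (m * k))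
    (hgM : ∑ m, g m ^ p ≤ M) (hg0 : n * g 0 ^ p ≤ M) :
    ∃ w : ZMod n, (1 / (n : ℝ) * ∑ k, F k * φ (k * w)) ^ p ≤ 2 / n * M * B := by
  have : Fact n.Prime := ⟨hn⟩
  obtain ⟨c, hc, hcF, hcB⟩ := hF
  have hn0 : (0 : ℝ) < n := by exact_mod_cast hn.pos
  have hB : 0 ≤ B := (Finset.sum_nonneg fun i _ => Real.rpow_nonneg (hc i) _).trans hcB
  have hmean : ∀ w : ZMod n, 1 / (n : ℝ) * ∑ k, F k * φ (k * w) = ∑ m, g m * c (-(m * w)) := by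
    intro w
    have h : ((∑ k, F k * φ (k * w) : ℝ) : ℂ) = ((n * ∑ m, g m * c (-(m * w)) : ℝ) : ℂ) := by
      push_cast
      simp only [hcF, hgφ, Finset.sum_mul_sum]
      calc ∑ k : ZMod n, ∑ l, ∑ m, (c l : ℂ) * ZMod.stdAddChar (l * k)
              * ((g m : ℂ) * ZMod.stdAddChar (m * (k * w)))
          = ∑ k : ZMod n, ∑ l, ∑ m, (c l : ℂ) * g m * ZMod.stdAddChar ((l + m * w) * k) := by
            refine Finset.sum_congr rfl fun k _ => Finset.sum_congr rfl fun l _ =>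
              Finset.sum_congr rfl fun m _ => ?_
            rw [show (l + m * w) * k = l * k + m * (k * w) by ring, AddChar.map_add_eq_mul]
            ring
        _ = ∑ m, ∑ l, (c l : ℂ) * g m * (if l + m * w = 0 then (n : ℂ) else 0) := by
            rw [Finset.sum_congr rfl fun _ _ => Finset.sum_comm, Finset.sum_comm]
            refine Finset.sum_congr rfl fun m _ => ?_
            rw [Finset.sum_comm]
            simp only [← sum_stdAddChar, Finset.mul_sum]
        _ = _ := by
            rw [Finset.mul_sum]
            refine Finset.sum_congr rfl fun m _ => ?_
            simp only [add_eq_zero_iff_eq_neg, mul_ite, mul_zero, Finset.sum_ite_eq',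
              Finset.mem_univ, if_true]
            ring
    rw [Complex.ofReal_inj.mp h, one_div, inv_mul_cancel_left₀ hn0.ne']
  have hle : ∀ w : ZMod n, (1 / (n : ℝ) * ∑ k, F k * φ (k * w)) ^ p
      ≤ ∑ m, g m ^ p * c (-(m * w)) ^ p := by
    intro w
    rw [hmean]
    refine (rpow_sum_le_sum_rpow _ (fun m => mul_nonneg (hg m) (hc _)) hp hp1).trans_eq ?_
    simp only [Real.mul_rpow (hg _) (hc _)]
  have hfib : ∀ m : ZMod n, ∑ w, g m ^ p * c (-(m * w)) ^ p
      ≤ g m ^ p * B + if m = 0 then n * g 0 ^ p * B else 0 := by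
    intro m
    rw [← Finset.mul_sum]
    by_cases hm : m = 0
    · subst hm
      have hc0 : c 0 ^ p ≤ B := (Finset.single_le_sum (f := fun m => c m ^ p)
        (fun i _ => Real.rpow_nonneg (hc i) _) (Finset.mem_univ 0)).trans hcB
      have hg0' := Real.rpow_nonneg (hg 0) p
      simp only [zero_mul, neg_zero, Finset.sum_const, Finset.card_univ, ZMod.card, nsmul_eq_mul,
        if_true]
      nlinarith [mul_nonneg hg0' hB, mul_le_mul_of_nonneg_left hc0 (mul_nonneg hn0.le hg0')]
    · rw [if_neg hm, add_zero]
      have hbij : Function.Bijective fun w : ZMod n => -(m * w) :=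
        neg_involutive.bijective.comp (mulLeft_bijective₀ m hm)
      rw [hbij.sum_comp (fun w => c w ^ p)]
      exact mul_le_mul_of_nonneg_left hcB (Real.rpow_nonneg (hg m) p)
  have htot : ∑ w : ZMod n, (1 / (n : ℝ) * ∑ k, F k * φ (k * w)) ^ p
      ≤ ∑ _w : ZMod n, 2 / n * M * B := by
    calc _ ≤ ∑ w, ∑ m, g m ^ p * c (-(m * w)) ^ p := Finset.sum_le_sum fun w _ => hle w
      _ = ∑ m, ∑ w, g m ^ p * c (-(m * w)) ^ p := Finset.sum_comm
      _ ≤ ∑ m, (g m ^ p * B + if m = 0 then n * g 0 ^ p * B else 0) :=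
          Finset.sum_le_sum fun m _ => hfib m
      _ = (∑ m, g m ^ p) * B + n * g 0 ^ p * B := by
          simp [Finset.sum_add_distrib, Finset.sum_mul]
      _ ≤ M * B + M * B := by gcongr
      _ = _ := by
          simp only [Finset.sum_const, Finset.card_univ, ZMod.card, nsmul_eq_mul]
          field_simp
          ring
  obtain ⟨w, -, hw⟩ := Finset.exists_le_of_sum_le Finset.univ_nonempty htot
  exact ⟨w, hw⟩

end HasFourierBound

theorem hasSum_int_inv_sq_rpow {p : ℝ} (hp : 1 / 2 < p) :
    HasSum (fun h : ℤ => (1 / (h : ℝ) ^ 2) ^ p) (muL (1 / p)) := by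
  have hp0 : 0 < p := by linarith
  have hnat : HasSum (fun h : ℕ => (1 / (h : ℝ) ^ 2) ^ p) (riemannZeta ((2 * p : ℝ) : ℂ)).re := by
    have hs : Summable fun h : ℕ => 1 / (h : ℝ) ^ (2 * p) :=
      Real.summable_one_div_nat_rpow.mpr (by linarith)
    have hz : riemannZeta ((2 * p : ℝ) : ℂ) = ((∑' h : ℕ, 1 / (h : ℝ) ^ (2 * p) : ℝ) : ℂ) := by
      rw [zeta_eq_tsum_one_div_nat_cpow (by rw [Complex.ofReal_re]; linarith), Complex.ofReal_tsum]
      refine tsum_congr fun h => ?_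
      rw [Complex.ofReal_div, Complex.ofReal_cpow (Nat.cast_nonneg h)]
      simp
    rw [hz, Complex.ofReal_re]
    convert hs.hasSum using 2 with h
    rw [Real.div_rpow zero_le_one (by positivity), Real.one_rpow, Real.rpow_mul (Nat.cast_nonneg h),
      Real.rpow_two]
  have h := HasSum.of_nat_of_neg (f := fun h : ℤ => (1 / (h : ℝ) ^ 2) ^ p)
    (by simpa only [Int.cast_natCast] using hnat)
    (by simpa only [Int.cast_neg, Int.cast_natCast, neg_sq] using hnat)
  have hmu : muL (1 / p) = (riemannZeta ((2 * p : ℝ) : ℂ)).re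
      + (riemannZeta ((2 * p : ℝ) : ℂ)).re - (1 / ((0 : ℤ) : ℝ) ^ 2) ^ p := by
    rw [muL, show 2 / (1 / p) = 2 * p by field_simp]
    simp only [Int.cast_zero, ne_eq, OfNat.ofNat_ne_zero, not_false_eq_true, zero_pow, div_zero,
      Real.zero_rpow hp0.ne']
    ring
  rw [hmu]
  exact h

/-- The Fourier series of `B₂`, folded onto `ℤ/n`. -/
theorem exists_bernoulli2_fourier (n : ℕ) [NeZero n] {p : ℝ} (hp : 1 / 2 < p) (hp1 : p ≤ 1) :
    ∃ g : ZMod n → ℝ, (∀ m, 0 ≤ g m) ∧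
      (∀ k : ZMod n, ((2 * Real.pi ^ 2 * bernoulli2 (k.val / n) : ℝ) : ℂ)
        = ∑ m, (g m : ℂ) * ZMod.stdAddChar (m * k)) ∧
      ∑ m, g m ^ p ≤ muL (1 / p) ∧ n * g 0 ^ p ≤ muL (1 / p) := by
  have hp0 : 0 < p := by linarith
  have hn0 : (0 : ℝ) < n := by exact_mod_cast NeZero.pos n
  have hn1 : (1 : ℝ) ≤ n := by exact_mod_cast NeZero.one_le
  set S : ZMod n → Set ℤ := fun m => {h : ℤ | (h : ZMod n) = m} with hSdef
  set f : ZMod n → ℤ → ℝ := fun m => (S m).indicator fun h => 1 / (h : ℝ) ^ 2 with hf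
  have hf0 : ∀ m h, 0 ≤ f m h := fun m h => Set.indicator_nonneg (fun _ _ => by positivity) h
  have hsum : ∀ m, Summable (f m) := fun m =>
    (Real.summable_one_div_int_pow.mpr one_lt_two).indicator _
  have hM := hasSum_int_inv_sq_rpow hp
  have hfp : ∀ m h, f m h ^ p = (S m).indicator (fun h : ℤ => (1 / (h : ℝ) ^ 2) ^ p) h := by
    intro m h
    simp only [hf, Set.indicator_apply]
    split_ifs
    · rfl
    · exact Real.zero_rpow hp0.ne'
  have hsump : ∀ m, Summable fun h => f m h ^ p := fun m => by
    simp only [hfp]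
    exact hM.summable.indicator _
  refine ⟨fun m => ∑' h, f m h, fun m => tsum_nonneg (hf0 m), fun k => ?_, ?_, ?_⟩
  · have hx : (k.val / n : ℝ) ∈ Set.Icc (0 : ℝ) 1 :=
      ⟨by positivity, (div_le_one hn0).mpr (by exact_mod_cast (ZMod.val_lt k).le)⟩
    have h1 := hasSum_one_div_pow_mul_fourier_mul_bernoulliFun le_rfl hx
    have h2 : HasSum (fun h : ℤ => ∑ m : ZMod n, (f m h : ℂ) * ZMod.stdAddChar (m * k))
        (∑ m, ((∑' h, f m h : ℝ) : ℂ) * ZMod.stdAddChar (m * k)) :=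
      hasSum_sum fun m _ => (Complex.hasSum_ofReal.mpr (hsum m).hasSum).mul_right _
    refine HasSum.unique ?_ h2
    convert h1 using 1
    · funext h
      rw [Finset.sum_eq_single (h : ZMod n)]
      · have hk : ((h : ZMod n) * k) = ((h * k.val : ℤ) : ZMod n) := by simp
        rw [hk, ZMod.stdAddChar_coe, fourier_coe_apply]
        simp only [hf, hSdef, Set.indicator_apply, Set.mem_ofPred_eq, if_true]
        push_cast
        congr 2
        ring
      · intro m _ hm
        simp [hf, hSdef, hm.symm]
      · simp
    · rw [bernoulliFun_two, bernoulli2]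
      rw [mul_pow, mul_pow, Complex.I_sq, Nat.factorial_two]
      push_cast
      ring
  · calc ∑ m, (∑' h, f m h) ^ p ≤ ∑ m, ∑' h, f m h ^ p := Finset.sum_le_sum fun m _ =>
          rpow_tsum_le_of_hasSum_rpow (hf0 m) hp0 hp1 (hsump m).hasSum
      _ = ∑' h, ∑ m, f m h ^ p := (Summable.tsum_finsetSum fun m _ => hsump m).symm
      _ = ∑' h : ℤ, (1 / (h : ℝ) ^ 2) ^ p := by
          refine tsum_congr fun h => ?_
          simp only [hfp, Set.indicator_apply, hSdef, Set.mem_ofPred_eq]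
          simp
      _ ≤ muL (1 / p) := hM.tsum_eq.le
  · have hinj : Function.Injective fun h : ℤ => (n : ℤ) * h :=
      mul_right_injective₀ (by exact_mod_cast NeZero.ne n)
    have h0 : HasSum (fun h => f 0 h ^ p) ((1 / (n : ℝ) ^ 2) ^ p * muL (1 / p)) := by
      rw [← hinj.hasSum_iff]
      · have hcomp : (fun h => f 0 h ^ p) ∘ (fun h : ℤ => (n : ℤ) * h)
            = fun h : ℤ => (1 / (n : ℝ) ^ 2) ^ p * (1 / (h : ℝ) ^ 2) ^ p := by
          funext h
          rw [Function.comp_apply, hfp, Set.indicator_of_mem (by simp [hSdef]),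
            ← Real.mul_rpow (by positivity) (by positivity)]
          push_cast
          rw [mul_pow, one_div_mul_one_div]
        rw [hcomp]
        exact hM.mul_left _
      · intro h hh
        rw [hfp, Set.indicator_of_notMem]
        intro hmem
        obtain ⟨t, rfl⟩ := (ZMod.intCast_zmod_eq_zero_iff_dvd h n).mp hmem
        exact hh ⟨t, rfl⟩
    have hM0 : 0 ≤ muL (1 / p) := hM.nonneg fun h => by positivity
    have hnp : n * (1 / (n : ℝ) ^ 2) ^ p ≤ 1 := by
      rw [Real.div_rpow zero_le_one (by positivity), Real.one_rpow, ← Real.rpow_natCast,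
        ← Real.rpow_mul hn0.le, mul_one_div, div_le_one (by positivity)]
      conv_lhs => rw [← Real.rpow_one (n : ℝ)]
      exact Real.rpow_le_rpow_of_exponent_le hn1 (by push_cast; linarith)
    calc n * (∑' h, f 0 h) ^ p ≤ n * ((1 / (n : ℝ) ^ 2) ^ p * muL (1 / p)) := by
          gcongr
          exact rpow_tsum_le_of_hasSum_rpow (hf0 0) hp0 hp1 h0
      _ = (n * (1 / (n : ℝ) ^ 2) ^ p) * muL (1 / p) := by ring
      _ ≤ muL (1 / p) := mul_le_of_le_one_left hM0 hnp

/-- The kernel `2π² B₂({k/n})` as a function on `ℤ/n`. -/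
noncomputable def latticeKernel (n : ℕ) (k : ZMod n) : ℝ :=
  2 * Real.pi ^ 2 * bernoulli2 (k.val / n)

theorem e2Sob_eq_sum_zmod (n d : ℕ) [NeZero n] (β γ a : Fin d → ℝ) (z : Fin d → ℕ) :
    e2Sob n d β γ a z = - ∏ j, (β j + γ j * (a j ^ 2 - a j + 1 / 3))
      + 1 / (n : ℝ) * ∑ k : ZMod n, ∏ j, (β j + γ j * (a j ^ 2 - a j + 1 / 3)
        + γ j / (2 * Real.pi ^ 2) * latticeKernel n (k * (z j : ZMod n))) := by
  rw [e2Sob]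
  congr 2
  refine Finset.sum_bij' (fun k _ => (k : ZMod n)) (fun k _ => k.val) (by simp)
    (fun k _ => Finset.mem_range.mpr (ZMod.val_lt k))
    (fun k hk => ZMod.val_cast_of_lt (Finset.mem_range.mp hk))
    (fun k _ => ZMod.natCast_zmod_val k) fun k _ => Finset.prod_congr rfl fun j _ => ?_
  have hπ : Real.pi ≠ 0 := Real.pi_ne_zero
  rw [latticeKernel, ← Nat.cast_mul, ← Nat.cast_mul, ZMod.val_natCast,
    Int.fract_div_natCast_eq_div_natCast_mod]
  field_simp
  ring

theorem prod_erase_eq_prod_lt_mul_prod_gt {ι : Type*} [Fintype ι] [LinearOrder ι] (f : ι → ℝ)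
    (s : ι) :
    ∏ j ∈ Finset.univ.erase s, f j = (∏ j with j < s, f j) * ∏ j with s < j, f j := by
  rw [← Finset.prod_union (Finset.disjoint_filter.mpr fun j _ h => h.asymm)]
  congr 1
  ext j
  simp [lt_or_lt_iff_ne]

/-- Error bound for the SCS algorithm in the shift-averaged weighted anchored Sobolev space:
for prime `n`, anchors `a_j ∈ [0,1]`, any initial vector `z⁰` and any SCS output `z*`, and any
`1 ≤ λ < 2`, `ê²_{n,d}(z*) ≤ Ĉ_{d,λ} n^{−λ}` where `Ĉ_{d,λ}` is the Korobov constant with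
`α = 1` and weights `β̂_j = β_j + γ_j c_j`, `γ̂_j = γ_j/(2π²)`. -/
theorem scs_sobolev_error_bound (n : ℕ) (hn : n.Prime) (d : ℕ) (hd : 1 ≤ d)
    (β γ a : Fin d → ℝ) (hβ : ∀ j, 0 < β j) (hγ : ∀ j, 0 < γ j)
    (ha : ∀ j, a j ∈ Set.Icc (0 : ℝ) 1)
    (z0 zstar : Fin d → ℕ) (hz0 : ∀ j, z0 j < n) (hzstar : ∀ j, zstar j < n)
    (hscs : ∀ s : Fin d, ∀ w < n,
      e2Sob n d β γ a (fun j => if j ≤ s then zstar j else z0 j)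
        ≤ e2Sob n d β γ a (fun j => if j < s then zstar j else if j = s then w else z0 j))
    (lam : ℝ) (hlam1 : 1 ≤ lam) (hlam2 : lam < 2) :
    e2Sob n d β γ a zstar
      ≤ (2 ^ lam
          * (∑ j, ((γ j / (2 * Real.pi ^ 2)) / (β j + γ j * (a j ^ 2 - a j + 1 / 3)))
              ^ (1 / lam)) ^ lam
          * (∏ j, ((β j + γ j * (a j ^ 2 - a j + 1 / 3)) ^ (1 / lam)
              + (γ j / (2 * Real.pi ^ 2)) ^ (1 / lam) * muL lam) ^ lam)
          * muL lam ^ lam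
          * Finset.univ.sup' (Finset.univ_nonempty_iff.mpr ⟨⟨0, hd⟩⟩)
              (fun s => (1 + ((γ s / (2 * Real.pi ^ 2))
                / (β s + γ s * (a s ^ 2 - a s + 1 / 3))) ^ (1 / lam) * muL lam) ^ (-lam)))
        * (n : ℝ) ^ (-lam) := by
  have : NeZero n := ⟨hn.ne_zero⟩
  have hn0 : (0 : ℝ) < n := by exact_mod_cast hn.pos
  have hl0 : 0 < lam := by linarith
  have hp : (0 : ℝ) < 1 / lam := by positivity
  have hp1 : 1 / lam ≤ 1 := (div_le_one hl0).mpr hlam1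
  obtain ⟨g, hg, hgφ, hgM, hg0⟩ := exists_bernoulli2_fourier n
    (p := 1 / lam) (one_div_lt_one_div_of_lt hl0 hlam2) hp1
  rw [one_div_one_div] at hgM hg0
  set p := 1 / lam with hpdef
  have hpl : p * lam = 1 := by rw [hpdef]; field_simp
  set M := muL lam with hMdef
  have hM : 0 ≤ M := (Finset.sum_nonneg fun m _ => Real.rpow_nonneg (hg m) p).trans hgM
  simp only [e2Sob_eq_sum_zmod] at hscs ⊢
  set b : Fin d → ℝ := fun j => β j + γ j * (a j ^ 2 - a j + 1 / 3) with hb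
  set u : Fin d → ℝ := fun j => γ j / (2 * Real.pi ^ 2) with hu
  have hb0 : ∀ j, 0 < b j := fun j => by
    have : 0 ≤ a j ^ 2 - a j + 1 / 3 := by nlinarith [sq_nonneg (a j - 1 / 2)]
    have := mul_nonneg (hγ j).le this
    have := hβ j
    simp only [hb]
    linarith
  have hu0 : ∀ j, 0 < u j := fun j => by have := hγ j; simp only [hu]; positivity
  change - ∏ j, b j + 1 / (n : ℝ) * ∑ k : ZMod n, ∏ j,
      (b j + u j * latticeKernel n (k * (zstar j : ZMod n)))
    ≤ (2 ^ lam * (∑ j, (u j / b j) ^ p) ^ lam * (∏ j, (b j ^ p + u j ^ p * M) ^ lam) * M ^ lam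
      * Finset.univ.sup' (Finset.univ_nonempty_iff.mpr ⟨⟨0, hd⟩⟩)
          (fun s => (1 + (u s / b s) ^ p * M) ^ (-lam))) * (n : ℝ) ^ (-lam)
  replace hscs : ∀ s : Fin d, ∀ w < n,
      - ∏ j, b j + 1 / (n : ℝ) * ∑ k : ZMod n, ∏ j, (b j + u j * latticeKernel n
          (k * ((if j ≤ s then zstar j else z0 j : ℕ) : ZMod n)))
      ≤ - ∏ j, b j + 1 / (n : ℝ) * ∑ k : ZMod n, ∏ j, (b j + u j * latticeKernel n
          (k * ((if j < s then zstar j else if j = s then w else z0 j : ℕ) : ZMod n))) := hscs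
  set φ := latticeKernel n with hφ
  have hφB : HasFourierBound n p M φ := ⟨g, hg, hgφ, hgM⟩
  -- Fourier bounds for the weighted kernels and for their shifts by the constant terms.
  have hker : ∀ (z : Fin d → ZMod n) (j : Fin d),
      HasFourierBound n p (u j ^ p * M) fun k => u j * φ (k * z j) := fun z j =>
    .mul hp hp1 (.const hp hp1 (hu0 j).le) (hφB.comp_mul hp hp1 _)
  have hfac : ∀ (z : Fin d → ZMod n) (j : Fin d),
      HasFourierBound n p (b j ^ p + u j ^ p * M) fun k => b j + u j * φ (k * z j) := fun z j =>
    .add hp hp1 (.const hp hp1 (hb0 j).le) (hker z j)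
  set Z : Fin d → Fin d → ZMod n := fun s j => ((if j < s then zstar j else z0 j : ℕ) : ZMod n)
    with hZ
  set F : Fin d → ZMod n → ℝ := fun s k => ∏ j ∈ Finset.univ.erase s, (b j + u j * φ (k * Z s j))
    with hF
  set P : Fin d → ℝ := fun s => ∏ j ∈ Finset.univ.erase s, (b j ^ p + u j ^ p * M) with hP
  have hFB : ∀ s, HasFourierBound n p (P s) (F s) := fun s => .prod hp hp1 _ (hfac (Z s))
  -- The part of the error with nonzero frequency in coordinate `s`, as a function of `z_s`.
  set Θ : Fin d → ZMod n → ℝ := fun s w => 1 / (n : ℝ) * ∑ k, F s k * φ (k * w) with hΘ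
  have hΘ0 : ∀ s w, 0 ≤ Θ s w := fun s w =>
    mul_nonneg (by positivity)
      (HasFourierBound.sum_nonneg (.mul hp hp1 (hFB s) (hφB.comp_mul hp hp1 w)))
  have hsplit : ∀ (s : Fin d) (y : Fin d → ZMod n), (∀ j, j ≠ s → y j = Z s j) →
      1 / (n : ℝ) * ∑ k : ZMod n, ∏ j, (b j + u j * φ (k * y j))
        = b s * (1 / (n : ℝ) * ∑ k, F s k) + u s * Θ s (y s) := by
    intro s y hy
    have h : ∀ k : ZMod n, ∏ j, (b j + u j * φ (k * y j))
        = b s * F s k + u s * (F s k * φ (k * y s)) := by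
      intro k
      have h' : ∏ j ∈ Finset.univ.erase s, (b j + u j * φ (k * y j)) = F s k :=
        Finset.prod_congr rfl fun j hj => by rw [hy j (Finset.ne_of_mem_erase hj)]
      rw [← Finset.mul_prod_erase _ _ (Finset.mem_univ s), h']
      ring
    simp only [h, Finset.sum_add_distrib, ← Finset.mul_sum, hΘ]
    ring
  have hopt : ∀ s w, Θ s (zstar s) ≤ Θ s w := by
    intro s w
    have h := hscs s w.val (ZMod.val_lt w)
    rw [add_le_add_iff_left, hsplit s (fun j => ((if j ≤ s then zstar j else z0 j : ℕ) : ZMod n))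
        fun j hj => by simp only [hZ, hj.le_iff_lt],
      hsplit s (fun j => ((if j < s then zstar j else if j = s then w.val else z0 j : ℕ) : ZMod n))
        fun j hj => by simp only [hZ, if_neg hj], add_le_add_iff_left] at h
    simpa using le_of_mul_le_mul_left h (hu0 s)
  have hΘle : ∀ s, Θ s (zstar s) ≤ (2 / n * M * P s) ^ lam := by
    intro s
    obtain ⟨w, hw⟩ := HasFourierBound.exists_mean_mul_comp_mul_le hn hp hp1 (hFB s) hg hgφ hgM hg0
    calc Θ s (zstar s) ≤ Θ s w := hopt s w
      _ = (Θ s w ^ p) ^ lam := by rw [← Real.rpow_mul (hΘ0 s w), hpl, Real.rpow_one]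
      _ ≤ _ := Real.rpow_le_rpow (Real.rpow_nonneg (hΘ0 s w) p) hw hl0.le
  -- Frequencies whose last nonzero coordinate is `s` contribute at most `u s * Θ s (zstar s)`.
  have hdecomp : - ∏ j, b j + 1 / (n : ℝ) * ∑ k : ZMod n, ∏ j, (b j + u j * φ (k * zstar j))
      ≤ ∑ s, u s * Θ s (zstar s) := by
    have h1 : ∀ k : ZMod n, ∏ j, (b j + u j * φ (k * zstar j)) = ∏ j, b j +
        ∑ s, u s * φ (k * zstar s) * (∏ j with j < s, (b j + u j * φ (k * zstar j)))
          * ∏ j with s < j, b j := fun k => Finset.prod_add_ordered _ _ _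
    have h2 : ∀ s, ∑ k : ZMod n, u s * φ (k * zstar s)
        * (∏ j with j < s, (b j + u j * φ (k * zstar j))) * ∏ j with s < j, b j
        ≤ u s * ∑ k, F s k * φ (k * zstar s) := by
      intro s
      obtain ⟨C, hC⟩ := HasFourierBound.exists_prod_add_sub_prod hp hp1
        {j | s < j} (fun j => (hb0 j).le) (hker fun j => (z0 j : ZMod n))
      have h := HasFourierBound.sum_nonneg (.mul hp hp1 (.mul hp hp1 (hker (fun j => zstar j) s)
        (.prod hp hp1 {j | j < s} (hfac fun j => (zstar j : ZMod n)))) hC)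
      rw [← sub_nonneg, Finset.mul_sum, ← Finset.sum_sub_distrib]
      refine h.trans_eq (Finset.sum_congr rfl fun k _ => ?_)
      have hlt : ∏ j with j < s, (b j + u j * φ (k * Z s j))
          = ∏ j with j < s, (b j + u j * φ (k * zstar j)) :=
        Finset.prod_congr rfl fun j hj => by
          simp only [hZ, if_pos (Finset.mem_filter.mp hj).2]
      have hgt : ∏ j with s < j, (b j + u j * φ (k * Z s j))
          = ∏ j with s < j, (b j + u j * φ (k * z0 j)) :=
        Finset.prod_congr rfl fun j hj => by
          simp only [hZ, if_neg (Finset.mem_filter.mp hj).2.not_gt]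
      simp only [hF, prod_erase_eq_prod_lt_mul_prod_gt, hlt, hgt]
      ring
    simp only [h1, Finset.sum_add_distrib, Finset.sum_const, Finset.card_univ, ZMod.card,
      nsmul_eq_mul]
    rw [mul_add, one_div, inv_mul_cancel_left₀ hn0.ne', neg_add_cancel_left, Finset.sum_comm,
      Finset.mul_sum]
    refine Finset.sum_le_sum fun s _ => ?_
    refine (mul_le_mul_of_nonneg_left (h2 s) (by positivity)).trans_eq ?_
    simp only [hΘ, one_div]
    ring
  have hρ : ∀ s, 0 ≤ (u s / b s) ^ p := fun s => Real.rpow_nonneg (div_pos (hu0 s) (hb0 s)).le p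
  have hfac0 : ∀ j, 0 ≤ b j ^ p + u j ^ p * M := fun j =>
    add_nonneg (Real.rpow_nonneg (hb0 j).le p)
      (mul_nonneg (Real.rpow_nonneg (hu0 j).le p) hM)
  have hP0 : 0 ≤ ∏ j, (b j ^ p + u j ^ p * M) := Finset.prod_nonneg fun j _ => hfac0 j
  set Q := Finset.univ.sup' (Finset.univ_nonempty_iff.mpr ⟨⟨0, hd⟩⟩)
    (fun s => (1 + (u s / b s) ^ p * M) ^ (-lam)) with hQ
  set K := 2 ^ lam * (∏ j, (b j ^ p + u j ^ p * M) ^ lam) * M ^ lam * (n : ℝ) ^ (-lam) with hK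
  have hK0 : 0 ≤ K := by
    have := Finset.prod_nonneg fun j (_ : j ∈ Finset.univ) => Real.rpow_nonneg (hfac0 j) lam
    positivity
  have hterm : ∀ s, u s * Θ s (zstar s)
      ≤ K * (((u s / b s) ^ p) ^ lam * (1 + (u s / b s) ^ p * M) ^ (-lam)) := by
    intro s
    have hden : 0 < 1 + (u s / b s) ^ p * M := by have := mul_nonneg (hρ s) hM; linarith
    have hPs : 0 ≤ P s := Finset.prod_nonneg fun j _ => hfac0 j
    have hbase : u s ^ p * P s
        = (u s / b s) ^ p * (∏ j, (b j ^ p + u j ^ p * M)) * (1 + (u s / b s) ^ p * M)⁻¹ := by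
      rw [eq_mul_inv_iff_mul_eq₀ hden.ne', ← Finset.mul_prod_erase _ _ (Finset.mem_univ s),
        Real.div_rpow (hu0 s).le (hb0 s).le]
      have : b s ^ p ≠ 0 := (Real.rpow_pos_of_pos (hb0 s) p).ne'
      change u s ^ p * P s * _ = _ * (_ * P s)
      field_simp
    refine (mul_le_mul_of_nonneg_left (hΘle s) (hu0 s).le).trans_eq ?_
    calc u s * (2 / n * M * P s) ^ lam = (2 * (n : ℝ)⁻¹ * M * (u s ^ p * P s)) ^ lam := by
          rw [show 2 * (n : ℝ)⁻¹ * M * (u s ^ p * P s) = u s ^ p * (2 / n * M * P s) by ring,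
            Real.mul_rpow (Real.rpow_nonneg (hu0 s).le p) (by positivity),
            ← Real.rpow_mul (hu0 s).le, hpl, Real.rpow_one]
      _ = _ := by
          have hρs := hρ s
          rw [hbase, Real.mul_rpow (by positivity) (by positivity),
            Real.mul_rpow (by positivity) (by positivity),
            Real.mul_rpow (by positivity) (by positivity),
            Real.mul_rpow (by positivity) (by positivity),
            Real.mul_rpow (by positivity) (by positivity),
            Real.inv_rpow hn0.le, Real.inv_rpow hden.le, ← Real.rpow_neg hn0.le,
            ← Real.rpow_neg hden.le, ← Real.finsetProd_rpow _ _ fun j _ => hfac0 j]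
          ring
  have hsum : ∑ s, ((u s / b s) ^ p) ^ lam ≤ (∑ s, (u s / b s) ^ p) ^ lam := by
    have h := rpow_sum_le_sum_rpow Finset.univ
      (fun s => Real.rpow_nonneg (hρ s) lam) hp hp1
    simp only [← Real.rpow_mul (hρ _), mul_comm lam p, hpl, Real.rpow_one] at h
    have h0 : 0 ≤ ∑ s, ((u s / b s) ^ p) ^ lam :=
      Finset.sum_nonneg fun s _ => Real.rpow_nonneg (hρ s) lam
    have h' := Real.rpow_le_rpow (Real.rpow_nonneg h0 p) h hl0.le
    rwa [← Real.rpow_mul h0, hpl, Real.rpow_one] at h'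
  have hQle : ∀ s, (1 + (u s / b s) ^ p * M) ^ (-lam) ≤ Q := fun s =>
    Finset.le_sup' (fun s => (1 + (u s / b s) ^ p * M) ^ (-lam)) (Finset.mem_univ s)
  have hQ0 : 0 ≤ Q := (Real.rpow_nonneg
    (add_nonneg zero_le_one (mul_nonneg (hρ ⟨0, hd⟩) hM)) _).trans (hQle ⟨0, hd⟩)
  calc _ ≤ ∑ s, u s * Θ s (zstar s) := hdecomp
    _ ≤ ∑ s, K * (((u s / b s) ^ p) ^ lam * (1 + (u s / b s) ^ p * M) ^ (-lam)) :=
        Finset.sum_le_sum fun s _ => hterm s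
    _ ≤ ∑ s, K * (((u s / b s) ^ p) ^ lam * Q) := Finset.sum_le_sum fun s _ =>
        mul_le_mul_of_nonneg_left (mul_le_mul_of_nonneg_left (hQle s)
          (Real.rpow_nonneg (hρ s) lam)) hK0
    _ = K * ((∑ s, ((u s / b s) ^ p) ^ lam) * Q) := by rw [Finset.sum_mul, Finset.mul_sum]
    _ ≤ K * ((∑ s, (u s / b s) ^ p) ^ lam * Q) := by gcongr
    _ = _ := by rw [hK]; ring
end

section
/- Let n ≥ 1 be a natural number, d ≥ 1, let β_1,…,β_d and γ_1,…,γ_d be positive reals, let a_1,…,a_d ∈ [0,1] and set c_j = a_j² − a_j + 1/3, β̂_j = β_j + γ_j c_j and γ̂_j = γ_j/(2π²). Then for every z ∈ ℤ^d, −∏_{j=1}^d (β_j + γ_j c_j) + (1/n) Σ_{k=0}^{n−1} ∏_{j=1}^d ( β_j + γ_j [ B₂({k z_j / n}) + c_j ] ) = Σ over h ∈ ℤ^d \ {0} with h·z ≡ 0 (mod n) of r_1(h)^{−1} ∏_{j : h_j ≠ 0} γ̂_j ∏_{j : h_j = 0} β̂_j, i.e., the shift-averaged Sobolev squared worst-case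 error equals the weighted Korobov squared worst-case error with smoothness α = 1 and weights β̂_j, γ̂_j. -/
/-- `r_1(h) = |h|²` for `h ≠ 0` and `r_1(0) = 1`. -/
noncomputable def rOne (h : ℤ) : ℝ := if h = 0 then 1 else |(h : ℝ)| ^ 2

/-- The sum over `ι^d` of a product of absolutely convergent series is the product of the sums. -/
theorem hasSum_and_summable_norm_prod_pi {ι R : Type*} [NormedCommRing R] [CompleteSpace R]
    [NormOneClass R] {d : ℕ} {f : Fin d → ι → R} {s : Fin d → R}
    (hf : ∀ j, HasSum (f j) (s j)) (hf' : ∀ j, Summable fun i => ‖f j i‖) :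
    HasSum (fun h : Fin d → ι => ∏ j, f j (h j)) (∏ j, s j) ∧
      Summable fun h : Fin d → ι => ‖∏ j, f j (h j)‖ := by
  induction d with
  | zero => exact ⟨by simp [hasSum_unique], Summable.of_finite⟩
  | succ d ih =>
    obtain ⟨h1, h2⟩ := ih (fun j => hf j.succ) (fun j => hf' j.succ)
    obtain ⟨e, he⟩ : ∃ e : ι × (Fin d → ι) ≃ (Fin (d + 1) → ι), ∀ p, e p = Fin.cons p.1 p.2 :=
      ⟨Fin.consEquiv fun _ => ι, fun _ => rfl⟩
    have key : (fun h : Fin (d + 1) → ι => ∏ j, f j (h j)) ∘ e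
        = fun p : ι × (Fin d → ι) => f 0 p.1 * ∏ j : Fin d, f j.succ (p.2 j) := by
      funext p
      simp [Fin.prod_univ_succ, he]
    constructor
    · rw [Fin.prod_univ_succ]
      refine e.hasSum_iff.1 ?_
      rw [key]
      exact HasSum.mul (f := f 0) (g := fun h : Fin d → ι => ∏ j : Fin d, f j.succ (h j))
        (hf 0) h1 (summable_mul_of_summable_norm (f := f 0)
          (g := fun h : Fin d → ι => ∏ j : Fin d, f j.succ (h j)) (hf' 0) h2)
    · refine e.summable_iff.1 ?_
      have h3 := Summable.mul_norm (f := f 0)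
        (g := fun h : Fin d → ι => ∏ j : Fin d, f j.succ (h j)) (hf' 0) h2
      convert h3 using 1
      funext p
      exact congrArg norm (congrFun key p)

theorem hasSum_prod_pi {ι R : Type*} [NormedCommRing R] [CompleteSpace R]
    [NormOneClass R] {d : ℕ} {f : Fin d → ι → R} {s : Fin d → R}
    (hf : ∀ j, HasSum (f j) (s j)) (hf' : ∀ j, Summable fun i => ‖f j i‖) :
    HasSum (fun h : Fin d → ι => ∏ j, f j (h j)) (∏ j, s j) :=
  (hasSum_and_summable_norm_prod_pi hf hf').1

/-- The Fourier series of `b + c B₂({x})`. -/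
theorem hasSum_ite_fourier (b c x : ℝ) :
    HasSum (fun h : ℤ => (if h = 0 then (b : ℂ) else ((c / (2 * Real.pi ^ 2) : ℝ) : ℂ)
        / (h : ℂ) ^ 2) * fourier h (x : UnitAddCircle))
      ((b + c * bernoulli2 (Int.fract x) : ℝ) : ℂ) := by
  have hx : ((Int.fract x : ℝ) : UnitAddCircle) = (x : UnitAddCircle) := by
    rw [← sub_eq_zero, ← AddCircle.coe_sub, AddCircle.coe_eq_zero_iff]
    exact ⟨-⌊x⌋, by simp [← Int.self_sub_floor]⟩
  have h1 := hasSum_one_div_pow_mul_fourier_mul_bernoulliFun (le_refl 2)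
    (x := Int.fract x) ⟨Int.fract_nonneg x, (Int.fract_lt_one x).le⟩
  rw [hx] at h1
  have h2 := (hasSum_ite_eq (0 : ℤ) (b : ℂ)).add
    (h1.mul_left ((c / (2 * Real.pi ^ 2) : ℝ) : ℂ))
  convert h2 using 1
  · funext h
    split_ifs with h0
    · simp [h0]
    · ring
  · have hpi : (Real.pi : ℂ) ≠ 0 := by exact_mod_cast Real.pi_ne_zero
    rw [bernoulliFun_two, bernoulli2]
    push_cast
    simp only [mul_pow, Complex.I_sq, Nat.factorial]
    push_cast
    field_simp

theorem summable_norm_ite_fourier (b c x : ℝ) :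
    Summable fun h : ℤ => ‖(if h = 0 then (b : ℂ) else ((c / (2 * Real.pi ^ 2) : ℝ) : ℂ)
        / (h : ℂ) ^ 2) * fourier h (x : UnitAddCircle)‖ :=
  (hasSum_ite_fourier b c x).summable.norm

/-- Orthogonality of the characters of `ℤ/n`, restricted to a rank-one lattice rule. -/
theorem inv_mul_sum_prod_fourier {n d : ℕ} (hn : n ≠ 0) (h z : Fin d → ℤ) :
    (1 / (n : ℂ)) * ∑ k ∈ Finset.range n, ∏ j,
        fourier (h j) (((k : ℝ) * (z j : ℝ) / (n : ℝ) : ℝ) : UnitAddCircle)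
      = if (n : ℤ) ∣ ∑ j, h j * z j then 1 else 0 := by
  have hn' : (n : ℂ) ≠ 0 := by exact_mod_cast hn
  have hζ := Complex.isPrimitiveRoot_exp n hn
  set ζ := Complex.exp (2 * Real.pi * Complex.I / n) with hζ_def
  set m := ∑ j, h j * z j with hm
  have hterm : ∀ k : ℕ, ∏ j,
      fourier (h j) (((k : ℝ) * (z j : ℝ) / (n : ℝ) : ℝ) : UnitAddCircle) = (ζ ^ m) ^ k := by
    intro k
    rw [hζ_def, ← Complex.exp_int_mul, ← Complex.exp_nat_mul]
    simp only [fourier_coe_apply]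
    rw [← Complex.exp_sum, hm]
    congr 1
    push_cast
    rw [Finset.sum_mul, Finset.mul_sum]
    refine Finset.sum_congr rfl fun j _ => ?_
    field_simp
  simp only [hterm]
  split_ifs with hdvd
  · rw [(hζ.zpow_eq_one_iff_dvd m).2 hdvd]
    simp [hn']
  · have hne : ζ ^ m - 1 ≠ 0 := sub_ne_zero.2 fun e => hdvd ((hζ.zpow_eq_one_iff_dvd m).1 e)
    have hone : (ζ ^ m) ^ n = 1 := by
      rw [← zpow_natCast, zpow_comm, zpow_natCast, hζ.pow_eq_one, one_zpow]
    have hgeom := mul_geom_sum (ζ ^ m) n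
    rw [hone, sub_self] at hgeom
    rw [(mul_eq_zero.1 hgeom).resolve_left hne, mul_zero]

theorem prod_ite_eq_rOne_inv_mul {d : ℕ} (b g : Fin d → ℝ) (h : Fin d → ℤ) :
    ∏ j, (if h j = 0 then b j else g j / (h j : ℝ) ^ 2)
      = (∏ j, rOne (h j))⁻¹ * (∏ j ∈ Finset.univ.filter (fun j => h j ≠ 0), g j)
        * (∏ j ∈ Finset.univ.filter (fun j => h j = 0), b j) := by
  rw [Finset.prod_filter, Finset.prod_filter, ← Finset.prod_inv_distrib,
    ← Finset.prod_mul_distrib, ← Finset.prod_mul_distrib]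
  refine Finset.prod_congr rfl fun j _ => ?_
  by_cases hj : h j = 0
  · simp [hj, rOne]
  · simp [hj, rOne, div_eq_inv_mul]

/-- The shift-averaged squared worst-case error in the weighted anchored Sobolev space equals
the weighted Korobov squared worst-case error with smoothness `α = 1` and modified weights
`β̂_j = β_j + γ_j c_j`, `γ̂_j = γ_j/(2π²)`, where `c_j = a_j² − a_j + 1/3`:
`−∏_j (β_j + γ_j c_j) + (1/n) ∑_{k<n} ∏_j (β_j + γ_j [B₂({k z_j/n}) + c_j])
  = ∑_{0 ≠ h ∈ ℤ^d, h·z ≡ 0 (mod n)} r_1(h)⁻¹ ∏_{j : h_j ≠ 0} γ̂_j ∏_{j : h_j = 0} β̂_j`. -/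
theorem sobolev_wce_eq_korobov_wce (n d : ℕ) (hn : 1 ≤ n) (hd : 1 ≤ d)
    (β γ a : Fin d → ℝ) (hβ : ∀ j, 0 < β j) (hγ : ∀ j, 0 < γ j)
    (ha : ∀ j, a j ∈ Set.Icc (0 : ℝ) 1) (z : Fin d → ℤ) :
    - ∏ j, (β j + γ j * (a j ^ 2 - a j + 1 / 3))
      + (1 / (n : ℝ)) * ∑ k ∈ Finset.range n, ∏ j,
          (β j + γ j * (bernoulli2 (Int.fract ((k : ℝ) * (z j : ℝ) / (n : ℝ)))
            + (a j ^ 2 - a j + 1 / 3)))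
      = ∑' h : Fin d → ℤ,
          if h ≠ 0 ∧ (n : ℤ) ∣ ∑ j, h j * z j then
            (∏ j, rOne (h j))⁻¹
              * (∏ j ∈ Finset.univ.filter (fun j => h j ≠ 0), γ j / (2 * Real.pi ^ 2))
              * (∏ j ∈ Finset.univ.filter (fun j => h j = 0),
                  (β j + γ j * (a j ^ 2 - a j + 1 / 3)))
          else 0 := by
  set b : Fin d → ℝ := fun j => β j + γ j * (a j ^ 2 - a j + 1 / 3) with hb
  set g : Fin d → ℝ := fun j => γ j / (2 * Real.pi ^ 2) with hg
  have hn0 : n ≠ 0 := by omega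
  have hk := fun k : ℕ => hasSum_prod_pi
    (fun j => hasSum_ite_fourier (b j) (γ j) ((k : ℝ) * (z j : ℝ) / (n : ℝ)))
    (fun j => summable_norm_ite_fourier (b j) (γ j) ((k : ℝ) * (z j : ℝ) / (n : ℝ)))
  have hsum := (hasSum_sum (s := Finset.range n) fun k _ => (hk k)).mul_left (1 / (n : ℂ))
  have hsub := (hasSum_ite_eq (0 : Fin d → ℤ) (-∏ j, (b j : ℂ))).add hsum
  rw [eq_comm]
  apply HasSum.tsum_eq
  rw [← Complex.hasSum_ofReal]
  convert hsub using 1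
  · funext h
    have hchar : (1 / (n : ℂ)) * ∑ k ∈ Finset.range n, ∏ j,
        ((if h j = 0 then (b j : ℂ) else ((γ j / (2 * Real.pi ^ 2) : ℝ) : ℂ) / (h j : ℂ) ^ 2)
          * fourier (h j) (((k : ℝ) * (z j : ℝ) / (n : ℝ) : ℝ) : UnitAddCircle))
        = (∏ j, (if h j = 0 then (b j : ℂ)
            else ((γ j / (2 * Real.pi ^ 2) : ℝ) : ℂ) / (h j : ℂ) ^ 2))
          * (if (n : ℤ) ∣ ∑ j, h j * z j then 1 else 0) := by
      rw [← inv_mul_sum_prod_fourier hn0 h z]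
      simp only [Finset.prod_mul_distrib, ← Finset.mul_sum]
      ring
    rw [hchar]
    by_cases h0 : h = 0
    · simp [h0]
    · by_cases hdvd : (n : ℤ) ∣ ∑ j, h j * z j
      · simp only [ne_eq, h0, not_false_eq_true, hdvd, and_self, if_true, if_false, mul_one,
          zero_add]
        rw [← prod_ite_eq_rOne_inv_mul b g h]
        push_cast
        refine Finset.prod_congr rfl fun j _ => ?_
        split_ifs <;> simp [hg]
      · simp [h0, hdvd]
  · push_cast
    congr 2
    refine Finset.sum_congr rfl fun k _ => Finset.prod_congr rfl fun j _ => ?_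
    simp only [hb]
    push_cast
    ring
end
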